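/- arXiv:2507.15176 — 7 statements merged into one kernel-verified Lean document; each statement's English description precedes it below -/
import Mathlib

section
/- Let X be a nonempty finite set, let P be a Markov transition matrix on X with stationary distribution π satisfying π(x) > 0 for all x, and suppose the spectral gap of P is at least γ for some γ ∈ [0,1]. Then for every distribution μ on X and every natural number t, ‖π − μP^t‖₁ ≤ (1−γ)^t · √(2 ‖μ/π‖_∞), where (μP^t)(y) is the t-step evolution of μ under P, ‖ν‖₁ := Σ_x |ν(x)|, and ‖μ/π‖_∞ := max_x μ(x)/π(x). -/
open Finset

/-- The spectral gap of a transition matrix `P` with respect to a distribution `π`. -/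
noncomputable def specGap {X : Type*} [Fintype X] (P : X → X → ℝ) (π : X → ℝ) : ℝ :=
  1 - sSup { r : ℝ | ∃ f : X → ℝ, f ≠ 0 ∧ ∑ x, π x * f x = 0 ∧
      r = Real.sqrt (∑ x, π x * |∑ y, P x y * f y| ^ 2) /
          Real.sqrt (∑ x, π x * |f x| ^ 2) }

/-- The `t`-step evolution of a row vector `ν` under the transition matrix `P`. -/
noncomputable def evolve {X : Type*} [Fintype X] (P : X → X → ℝ) (ν : X → ℝ) : ℕ → X → ℝ
  | 0 => ν
  | t + 1 => fun y => ∑ x, evolve P ν t x * P x y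

/-- Jensen's inequality for averaging against a row of a transition matrix, integrated against a
stationary distribution. -/
theorem sum_stationary_mul_sq_le {X : Type*} [Fintype X] {P : X → X → ℝ} {π : X → ℝ}
    (hP0 : ∀ x y, 0 ≤ P x y) (hP1 : ∀ x, ∑ y, P x y = 1) (hπ0 : ∀ x, 0 ≤ π x)
    (hstat : ∀ y, ∑ x, π x * P x y = π y) (f : X → ℝ) :
    ∑ x, π x * (∑ y, P x y * f y) ^ 2 ≤ ∑ x, π x * f x ^ 2 := by
  calc ∑ x, π x * (∑ y, P x y * f y) ^ 2
      ≤ ∑ x, π x * ∑ y, P x y * f y ^ 2 := by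
        refine sum_le_sum fun x _ => mul_le_mul_of_nonneg_left ?_ (hπ0 x)
        have h := sum_sq_le_sum_mul_sum_of_sq_le_mul univ (r := fun y => P x y * f y)
          (f := fun y => P x y) (g := fun y => P x y * f y ^ 2) (fun y _ => hP0 x y)
          (fun y _ => mul_nonneg (hP0 x y) (sq_nonneg _)) (fun y _ => le_of_eq (by ring))
        rwa [hP1 x, one_mul] at h
    _ = ∑ y, π y * f y ^ 2 := by
        simp_rw [mul_sum]
        rw [sum_comm]
        refine sum_congr rfl fun y _ => ?_
        rw [← hstat y, sum_mul]
        exact sum_congr rfl fun x _ => by ring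

/-- A lower bound on the spectral gap contracts mean-zero functions in `L²(π)`. -/
theorem sum_mul_sq_le_of_le_specGap {X : Type*} [Fintype X] {P : X → X → ℝ} {π : X → ℝ}
    (hP0 : ∀ x y, 0 ≤ P x y) (hP1 : ∀ x, ∑ y, P x y = 1) (hπ0 : ∀ x, 0 < π x)
    (hstat : ∀ y, ∑ x, π x * P x y = π y) {γ : ℝ} (hgap : γ ≤ specGap P π)
    (f : X → ℝ) (hf : ∑ x, π x * f x = 0) :
    ∑ x, π x * (∑ y, P x y * f y) ^ 2 ≤ (1 - γ) ^ 2 * ∑ x, π x * f x ^ 2 := by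
  by_cases hf0 : f = 0
  · simp [hf0]
  obtain ⟨z, hz⟩ := Function.ne_iff.mp hf0
  have hpos : 0 < ∑ x, π x * f x ^ 2 :=
    sum_pos' (fun x _ => mul_nonneg (hπ0 x).le (sq_nonneg _))
      ⟨z, mem_univ z, mul_pos (hπ0 z) (sq_pos_iff.mpr hz)⟩
  have hle : √(∑ x, π x * (∑ y, P x y * f y) ^ 2) / √(∑ x, π x * f x ^ 2) ≤ 1 - γ := by
    have hsup := le_sub_comm.mp hgap
    refine (le_csSup ?_ ?_).trans hsup
    · refine ⟨1, ?_⟩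
      rintro r ⟨g, -, -, rfl⟩
      simp only [sq_abs]
      exact div_le_one_of_le₀ (Real.sqrt_le_sqrt
        (sum_stationary_mul_sq_le hP0 hP1 (fun x => (hπ0 x).le) hstat g)) (Real.sqrt_nonneg _)
    · exact ⟨f, hf0, hf, by simp only [sq_abs]⟩
  rw [div_le_iff₀ (Real.sqrt_pos.mpr hpos)] at hle
  have h := pow_le_pow_left₀ (Real.sqrt_nonneg _) hle 2
  rwa [mul_pow, Real.sq_sqrt hpos.le, Real.sq_sqrt
    (sum_nonneg fun x _ => mul_nonneg (hπ0 x).le (sq_nonneg _))] at h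

/-- A lower bound on the spectral gap contracts signed measures of total mass zero in the
chi-square norm. -/
theorem sum_sq_div_le_of_le_specGap {X : Type*} [Fintype X] {P : X → X → ℝ} {π : X → ℝ}
    (hP0 : ∀ x y, 0 ≤ P x y) (hP1 : ∀ x, ∑ y, P x y = 1) (hπ0 : ∀ x, 0 < π x)
    (hstat : ∀ y, ∑ x, π x * P x y = π y) {γ : ℝ} (hgap : γ ≤ specGap P π)
    (d : X → ℝ) (hd : ∑ x, d x = 0) :
    ∑ y, (∑ x, d x * P x y) ^ 2 / π y ≤ (1 - γ) ^ 2 * ∑ x, d x ^ 2 / π x := by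
  set e : X → ℝ := fun y => ∑ x, d x * P x y with he
  have hπ : ∀ x, π x ≠ 0 := fun x => (hπ0 x).ne'
  have hd0 : 0 ≤ ∑ x, d x ^ 2 / π x := sum_nonneg fun x _ => div_nonneg (sq_nonneg _) (hπ0 x).le
  have he0 : 0 ≤ ∑ x, e x ^ 2 / π x := sum_nonneg fun x _ => div_nonneg (sq_nonneg _) (hπ0 x).le
  have hmean : ∑ y, π y * (e y / π y) = 0 := by
    calc ∑ y, π y * (e y / π y) = ∑ y, e y := sum_congr rfl fun y _ => mul_div_cancel₀ _ (hπ y)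
      _ = ∑ x, d x * ∑ y, P x y := by
        simp_rw [he, mul_sum]
        exact sum_comm
      _ = 0 := by simp [hP1, hd]
  have hnorm : ∑ y, π y * (e y / π y) ^ 2 = ∑ y, e y ^ 2 / π y :=
    sum_congr rfl fun y _ => by
      have := hπ y
      field_simp
  have hdual : ∑ y, e y ^ 2 / π y = ∑ x, d x * ∑ y, P x y * (e y / π y) := by
    simp_rw [mul_sum]
    rw [sum_comm]
    refine sum_congr rfl fun y _ => ?_
    calc e y ^ 2 / π y = (∑ x, d x * P x y) * (e y / π y) := by rw [sq, mul_div_assoc]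
      _ = _ := by
        rw [sum_mul]
        exact sum_congr rfl fun x _ => by ring
  have hcontr := sum_mul_sq_le_of_le_specGap hP0 hP1 hπ0 hstat hgap _ hmean
  rw [hnorm] at hcontr
  have hcs := sum_sq_le_sum_mul_sum_of_sq_le_mul univ
    (r := fun x => d x * ∑ y, P x y * (e y / π y))
    (f := fun x => d x ^ 2 / π x) (g := fun x => π x * (∑ y, P x y * (e y / π y)) ^ 2)
    (fun x _ => div_nonneg (sq_nonneg _) (hπ0 x).le)
    (fun x _ => mul_nonneg (hπ0 x).le (sq_nonneg _))
    (fun x _ => le_of_eq (by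
      have := hπ x
      field_simp))
  rw [← hdual] at hcs
  have h := hcs.trans (mul_le_mul_of_nonneg_left hcontr hd0)
  rcases he0.eq_or_lt with h0 | h0
  · rw [← h0]
    positivity
  · refine le_of_mul_le_mul_right ?_ h0
    linarith

theorem sum_evolve {X : Type*} [Fintype X] {P : X → X → ℝ} (hP1 : ∀ x, ∑ y, P x y = 1)
    (ν : X → ℝ) (t : ℕ) : ∑ y, evolve P ν t y = ∑ y, ν y := by
  induction t with
  | zero => rfl
  | succ t ih =>
    simp only [evolve]
    rw [sum_comm]
    simp_rw [← mul_sum, hP1, mul_one, ih]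

theorem sum_sq_evolve_sub_div_le {X : Type*} [Fintype X] {P : X → X → ℝ} {π : X → ℝ}
    (hP0 : ∀ x y, 0 ≤ P x y) (hP1 : ∀ x, ∑ y, P x y = 1) (hπ0 : ∀ x, 0 < π x)
    (hstat : ∀ y, ∑ x, π x * P x y = π y) {γ : ℝ} (hgap : γ ≤ specGap P π)
    (μ : X → ℝ) (hμ : ∑ x, μ x = ∑ x, π x) (t : ℕ) :
    ∑ y, (evolve P μ t y - π y) ^ 2 / π y ≤
      ((1 - γ) ^ t) ^ 2 * ∑ x, (μ x - π x) ^ 2 / π x := by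
  induction t with
  | zero => simp [evolve]
  | succ t ih =>
    have h := sum_sq_div_le_of_le_specGap hP0 hP1 hπ0 hstat hgap (fun x => evolve P μ t x - π x)
      (by rw [sum_sub_distrib, sum_evolve hP1, hμ, sub_self])
    simp only [sub_mul, sum_sub_distrib, hstat] at h
    calc _ ≤ _ := h
      _ ≤ (1 - γ) ^ 2 * (((1 - γ) ^ t) ^ 2 * ∑ x, (μ x - π x) ^ 2 / π x) :=
        mul_le_mul_of_nonneg_left ih (sq_nonneg _)
      _ = _ := by ring

/-- The chi-square divergence of `μ` from `π` is at most `‖μ/π‖_∞ - 1`. -/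
theorem sum_sq_sub_div_le_iSup {X : Type*} [Fintype X] {π μ : X → ℝ} (hπ0 : ∀ x, 0 < π x)
    (hπ1 : ∑ x, π x = 1) (hμ0 : ∀ x, 0 ≤ μ x) (hμ1 : ∑ x, μ x = 1) :
    ∑ x, (μ x - π x) ^ 2 / π x ≤ (⨆ x, μ x / π x) - 1 := by
  calc ∑ x, (μ x - π x) ^ 2 / π x = ∑ x, (μ x * (μ x / π x) - 2 * μ x + π x) :=
        sum_congr rfl fun x _ => by
          have := (hπ0 x).ne'
          field_simp
          ring
    _ ≤ ∑ x, (μ x * (⨆ x, μ x / π x) - 2 * μ x + π x) := by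
        gcongr with x _
        · exact hμ0 x
        · exact le_ciSup (f := fun x => μ x / π x) (Set.finite_range _).bddAbove x
    _ = (⨆ x, μ x / π x) - 1 := by
        rw [sum_add_distrib, sum_sub_distrib, ← sum_mul, ← mul_sum, hμ1, hπ1]
        ring

/-- If `P` has positive stationary distribution `π` and spectral
gap at least `γ ∈ [0,1]`, then for every distribution `μ` and every `t`,
`‖π − μP^t‖₁ ≤ (1−γ)^t √(2 ‖μ/π‖_∞)`. -/
theorem mixing_from_spectral_gap {X : Type*} [Fintype X] [Nonempty X]
    (P : X → X → ℝ) (π : X → ℝ)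
    (hP0 : ∀ x y, 0 ≤ P x y) (hP1 : ∀ x, ∑ y, P x y = 1)
    (hπ0 : ∀ x, 0 < π x) (hπ1 : ∑ x, π x = 1)
    (hstat : ∀ y, ∑ x, π x * P x y = π y)
    (γ : ℝ) (hγ0 : 0 ≤ γ) (hγ1 : γ ≤ 1) (hgap : γ ≤ specGap P π)
    (μ : X → ℝ) (hμ0 : ∀ x, 0 ≤ μ x) (hμ1 : ∑ x, μ x = 1)
    (t : ℕ) :
    ∑ y, |π y - evolve P μ t y| ≤
      (1 - γ) ^ t * Real.sqrt (2 * ⨆ x, μ x / π x) := by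
  have hM := sum_sq_sub_div_le_iSup hπ0 hπ1 hμ0 hμ1
  have hM0 : 0 ≤ ∑ x, (μ x - π x) ^ 2 / π x :=
    sum_nonneg fun x _ => div_nonneg (sq_nonneg _) (hπ0 x).le
  have hcs := sum_sq_le_sum_mul_sum_of_sq_le_mul univ (r := fun y => |π y - evolve P μ t y|)
    (f := π) (g := fun y => (evolve P μ t y - π y) ^ 2 / π y) (fun y _ => (hπ0 y).le)
    (fun y _ => div_nonneg (sq_nonneg _) (hπ0 y).le)
    (fun y _ => le_of_eq (by rw [sq_abs, mul_div_cancel₀ _ (hπ0 y).ne', sub_sq_comm]))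
  rw [hπ1, one_mul] at hcs
  refine le_of_abs_le (abs_le_of_sq_le_sq ?_
    (mul_nonneg (pow_nonneg (sub_nonneg.mpr hγ1) t) (Real.sqrt_nonneg _)))
  have hsup : 0 ≤ 2 * ⨆ x, μ x / π x := by linarith
  rw [mul_pow, Real.sq_sqrt hsup]
  calc _ ≤ _ := hcs
    _ ≤ _ := sum_sq_evolve_sub_div_le hP0 hP1 hπ0 hstat hgap μ (hμ1.trans hπ1.symm) t
    _ ≤ _ := mul_le_mul_of_nonneg_left (by linarith) (sq_nonneg _)
end

section
/- Let X be a nonempty finite set, let P be a Markov transition matrix on X with stationary distribution π satisfying π(x) > 0 for all x, let μ be a distribution on X, let δ ∈ (0,1], and let π_δ be the unique stationary distribution of the PageRank chain P(δ)(x,y) := (1−δ) P(x,y) + δ μ(y). Then for every p ≥ 1, ‖π_δ/π‖_{p,π} ≤ ‖μ/π‖_{p,π}, where (ν/π)(x) := ν(x)/π(x) and ‖f‖_{p,π} := (Σ_x π(x)|f(x)|^p)^{1/p}. In particular, ‖π_δ/π‖_∞ ≤ ‖μ/π‖_∞, where ‖f‖_∞ := max_x |f(x)|. -/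
open Finset

/-- A stationary distribution of the PageRank chain, relative to `π`, is a convex combination of its
average under the time reversal of `P` and of the relative restart density. -/
lemma pagerank_density_eq {X : Type*} [Fintype X] {P : X → X → ℝ} {π μ πδ : X → ℝ} {δ : ℝ}
    (hπ0 : ∀ x, 0 < π x) (hπδ1 : ∑ x, πδ x = 1)
    (hπδstat : ∀ y, ∑ x, πδ x * ((1 - δ) * P x y + δ * μ y) = πδ y) (y : X) :
    πδ y / π y = (1 - δ) * ∑ x, π x * P x y / π y * (πδ x / π x) + δ * (μ y / π y) := by
  have hrec : πδ y = (1 - δ) * ∑ x, πδ x * P x y + δ * μ y := by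
    calc πδ y = ∑ x, ((1 - δ) * (πδ x * P x y) + πδ x * (δ * μ y)) := by
          rw [← hπδstat y]
          exact sum_congr rfl fun x _ => by ring
      _ = _ := by rw [sum_add_distrib, ← mul_sum, ← sum_mul, hπδ1, one_mul]
  have hsum : ∑ x, π x * P x y / π y * (πδ x / π x) = (∑ x, πδ x * P x y) / π y := by
    rw [sum_div]
    refine sum_congr rfl fun x _ => ?_
    have := (hπ0 x).ne'
    have := (hπ0 y).ne'
    field_simp
  rw [hsum]
  nth_rw 1 [hrec]
  ring

lemma sum_reversal_eq_one {X : Type*} [Fintype X] {P : X → X → ℝ} {π : X → ℝ}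
    (hπ0 : ∀ x, 0 < π x) (hstat : ∀ y, ∑ x, π x * P x y = π y) (y : X) :
    ∑ x, π x * P x y / π y = 1 := by
  rw [← sum_div, hstat, div_self (hπ0 y).ne']

/-- Averaging a convex function of the PageRank density against `π` gives at most the average of
the same function of the restart density. -/
lemma pagerank_convex_sum_le {X : Type*} [Fintype X] {P : X → X → ℝ} {π μ πδ : X → ℝ} {δ : ℝ}
    (hP0 : ∀ x y, 0 ≤ P x y) (hP1 : ∀ x, ∑ y, P x y = 1) (hπ0 : ∀ x, 0 < π x)
    (hstat : ∀ y, ∑ x, π x * P x y = π y) (hμ0 : ∀ x, 0 ≤ μ x)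
    (hδ0 : 0 < δ) (hδ1 : δ ≤ 1) (hπδ0 : ∀ x, 0 ≤ πδ x) (hπδ1 : ∑ x, πδ x = 1)
    (hπδstat : ∀ y, ∑ x, πδ x * ((1 - δ) * P x y + δ * μ y) = πδ y)
    {φ : ℝ → ℝ} (hφ : ConvexOn ℝ (Set.Ici 0) φ) :
    ∑ x, π x * φ (πδ x / π x) ≤ ∑ x, π x * φ (μ x / π x) := by
  have hf0 : ∀ x, 0 ≤ πδ x / π x := fun x => div_nonneg (hπδ0 x) (hπ0 x).le
  have hg0 : ∀ x, 0 ≤ μ x / π x := fun x => div_nonneg (hμ0 x) (hπ0 x).le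
  have hw0 : ∀ x y, 0 ≤ π x * P x y / π y := fun x y =>
    div_nonneg (mul_nonneg (hπ0 x).le (hP0 x y)) (hπ0 y).le
  have hδ' : 0 ≤ 1 - δ := sub_nonneg.2 hδ1
  have hpoint : ∀ y, π y * φ (πδ y / π y) ≤
      (1 - δ) * (∑ x, π x * P x y * φ (πδ x / π x)) + δ * (π y * φ (μ y / π y)) := by
    intro y
    have hjensen : φ (∑ x, π x * P x y / π y * (πδ x / π x)) ≤
        ∑ x, π x * P x y / π y * φ (πδ x / π x) :=
      hφ.map_sum_le (fun x _ => hw0 x y) (sum_reversal_eq_one hπ0 hstat y) fun x _ => hf0 x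
    have hsplit := hφ.2 (Set.mem_Ici.2
      (sum_nonneg fun x (_ : x ∈ univ) => mul_nonneg (hw0 x y) (hf0 x)))
      (Set.mem_Ici.2 (hg0 y)) hδ' hδ0.le (sub_add_cancel 1 δ)
    simp only [smul_eq_mul] at hsplit
    rw [← pagerank_density_eq hπ0 hπδ1 hπδstat y] at hsplit
    have hle := mul_le_mul_of_nonneg_left
      (hsplit.trans (add_le_add_left (mul_le_mul_of_nonneg_left hjensen hδ') _)) (hπ0 y).le
    refine hle.trans_eq ?_
    have hsum : π y * ∑ x, π x * P x y / π y * φ (πδ x / π x) =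
        ∑ x, π x * P x y * φ (πδ x / π x) := by
      rw [mul_sum]
      refine sum_congr rfl fun x _ => ?_
      have := (hπ0 y).ne'
      field_simp
    rw [← hsum]
    ring
  have htotal := sum_le_sum fun y (_ : y ∈ univ) => hpoint y
  have hinv : ∑ y, ∑ x, π x * P x y * φ (πδ x / π x) = ∑ x, π x * φ (πδ x / π x) := by
    rw [sum_comm]
    refine sum_congr rfl fun x _ => ?_
    rw [← sum_mul, ← mul_sum, hP1, mul_one]
  rw [sum_add_distrib, ← mul_sum, ← mul_sum, hinv] at htotal
  exact le_of_mul_le_mul_left (by linarith) hδ0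

/-- The stationary distribution `π_δ` of the PageRank chain
`(1−δ)P + δ𝟙ᵀμ` satisfies `‖π_δ/π‖_{p,π} ≤ ‖μ/π‖_{p,π}` for all `p ≥ 1`, and in
particular `‖π_δ/π‖_∞ ≤ ‖μ/π‖_∞`. -/
theorem pagerank_density_contraction {X : Type*} [Fintype X] [Nonempty X]
    (P : X → X → ℝ) (π : X → ℝ)
    (hP0 : ∀ x y, 0 ≤ P x y) (hP1 : ∀ x, ∑ y, P x y = 1)
    (hπ0 : ∀ x, 0 < π x) (hπ1 : ∑ x, π x = 1)
    (hstat : ∀ y, ∑ x, π x * P x y = π y)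
    (μ : X → ℝ) (hμ0 : ∀ x, 0 ≤ μ x) (hμ1 : ∑ x, μ x = 1)
    (δ : ℝ) (hδ0 : 0 < δ) (hδ1 : δ ≤ 1)
    (πδ : X → ℝ) (hπδ0 : ∀ x, 0 ≤ πδ x) (hπδ1 : ∑ x, πδ x = 1)
    (hπδstat : ∀ y, ∑ x, πδ x * ((1 - δ) * P x y + δ * μ y) = πδ y) :
    (∀ p : ℝ, 1 ≤ p →
      (∑ x, π x * |πδ x / π x| ^ p) ^ (1 / p) ≤
        (∑ x, π x * |μ x / π x| ^ p) ^ (1 / p)) ∧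
    (⨆ x, |πδ x / π x|) ≤ ⨆ x, |μ x / π x| := by
  have hf0 : ∀ x, 0 ≤ πδ x / π x := fun x => div_nonneg (hπδ0 x) (hπ0 x).le
  have hg0 : ∀ x, 0 ≤ μ x / π x := fun x => div_nonneg (hμ0 x) (hπ0 x).le
  simp only [abs_of_nonneg (hf0 _), abs_of_nonneg (hg0 _)]
  refine ⟨fun p hp => ?_, ?_⟩
  · refine Real.rpow_le_rpow
      (sum_nonneg fun x _ => mul_nonneg (hπ0 x).le (Real.rpow_nonneg (hf0 x) p)) ?_ (by positivity)
    exact pagerank_convex_sum_le hP0 hP1 hπ0 hstat hμ0 hδ0 hδ1 hπδ0 hπδ1 hπδstat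
      (convexOn_rpow hp)
  · obtain ⟨y, hy⟩ := Finite.exists_max fun x => πδ x / π x
    refine ciSup_le fun x => (hy x).trans ?_
    refine le_trans ?_ (le_ciSup (Set.finite_range fun x => μ x / π x).bddAbove y)
    have havg : ∑ x, π x * P x y / π y * (πδ x / π x) ≤ πδ y / π y := by
      calc _ ≤ ∑ x, π x * P x y / π y * (πδ y / π y) :=
            sum_le_sum fun x _ => mul_le_mul_of_nonneg_left (hy x)
              (div_nonneg (mul_nonneg (hπ0 x).le (hP0 x y)) (hπ0 y).le)
        _ = πδ y / π y := by rw [← sum_mul, sum_reversal_eq_one hπ0 hstat, one_mul]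
    have heq := pagerank_density_eq hπ0 hπδ1 hπδstat y
    have hle := mul_le_mul_of_nonneg_left havg (sub_nonneg.2 hδ1)
    exact le_of_mul_le_mul_left (by linarith) hδ0
end

section
/- There exists an absolute constant C > 0 with the following property. Let X be a nonempty finite set, let P be a Markov transition matrix on X with stationary distribution π satisfying π(x) > 0 for all x, and suppose the spectral gap of P is at least γ for some γ ∈ (0,1]. Let μ be a distribution on X, let δ ∈ (0,1], and let π_δ be the unique stationary distribution of the PageRank chain P(δ)(x,y) := (1−δ) P(x,y) + δ μ(y). Then ‖π − π_δ‖₁ ≤ C · (δ/γ) · (1 + log(1 + γ ‖μ/π‖_∞ / δ)), where ‖ν‖₁ := Σ_x |ν(x)| and ‖μ/π‖_∞ := max_x μ(x)/π(x). -/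
open Finset

namespace PageRank

variable {X : Type*} [Fintype X]

/-- The weighted norm `‖f‖_{1,π}`. -/
noncomputable def l1Norm (π f : X → ℝ) : ℝ := ∑ x, π x * |f x|

/-- The weighted norm `‖f‖_{2,π}`. -/
noncomputable def l2Norm (π f : X → ℝ) : ℝ := Real.sqrt (∑ x, π x * |f x| ^ 2)

/-- The adjoint of `P` in `ℓ²(π)`, acting on densities with respect to `π`. -/
noncomputable def adjointOp (P : X → X → ℝ) (π : X → ℝ) : (X → ℝ) →ₗ[ℝ] (X → ℝ) where
  toFun f y := (∑ x, π x * P x y * f x) / π y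
  map_add' f g := by
    ext y
    simp only [Pi.add_apply, mul_add, sum_add_distrib, add_div]
  map_smul' c f := by
    ext y
    simp only [Pi.smul_apply, smul_eq_mul, RingHom.id_apply, ← mul_div_assoc, mul_sum]
    congr 1
    exact sum_congr rfl fun x _ => by ring

variable {P : X → X → ℝ} {π : X → ℝ}

theorem mul_adjointOp_apply (hpos : ∀ x, 0 < π x) (f : X → ℝ) (y : X) :
    π y * adjointOp P π f y = ∑ x, π x * P x y * f x :=
  mul_div_cancel₀ _ (hpos y).ne'

theorem sum_mul_adjointOp_mul (hpos : ∀ x, 0 < π x) (f g : X → ℝ) :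
    ∑ y, π y * (adjointOp P π f y * g y) = ∑ x, π x * (f x * ∑ y, P x y * g y) := by
  simp_rw [← mul_assoc, mul_adjointOp_apply hpos, mul_sum, sum_mul]
  rw [sum_comm]
  exact sum_congr rfl fun x _ => sum_congr rfl fun y _ => by ring

theorem sum_mul_adjointOp (hP1 : ∀ x, ∑ y, P x y = 1) (hpos : ∀ x, 0 < π x) (f : X → ℝ) :
    ∑ y, π y * adjointOp P π f y = ∑ x, π x * f x := by
  simpa [hP1] using sum_mul_adjointOp_mul (P := P) hpos f 1

theorem l2Norm_nonneg (f : X → ℝ) : 0 ≤ l2Norm π f := Real.sqrt_nonneg _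

theorem l2Norm_sq (hpos : ∀ x, 0 < π x) (f : X → ℝ) :
    l2Norm π f ^ 2 = ∑ x, π x * (f x * f x) := by
  rw [l2Norm, Real.sq_sqrt (sum_nonneg fun x _ => mul_nonneg (hpos x).le (sq_nonneg _))]
  exact sum_congr rfl fun x _ => by rw [sq_abs, sq]

theorem l2Norm_pos (hpos : ∀ x, 0 < π x) {f : X → ℝ} (hf : f ≠ 0) : 0 < l2Norm π f := by
  obtain ⟨x, hx⟩ := Function.ne_iff.mp hf
  refine Real.sqrt_pos.mpr (sum_pos' (fun y _ => mul_nonneg (hpos y).le (sq_nonneg _))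
    ⟨x, mem_univ x, mul_pos (hpos x) (pow_pos (abs_pos.mpr hx) 2)⟩)

theorem sum_mul_mul_le_l2Norm (hpos : ∀ x, 0 < π x) (f g : X → ℝ) :
    ∑ x, π x * (f x * g x) ≤ l2Norm π f * l2Norm π g := by
  have h := Real.sum_mul_le_sqrt_mul_sqrt univ
    (fun x => Real.sqrt (π x) * f x) (fun x => Real.sqrt (π x) * g x)
  simp only [mul_pow, Real.sq_sqrt (hpos _).le] at h
  simp only [l2Norm, sq_abs]
  refine le_trans (le_of_eq (sum_congr rfl fun x _ => ?_)) h
  linear_combination -(f x * g x) * Real.mul_self_sqrt (hpos x).le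

theorem l1Norm_le_l2Norm (hpos : ∀ x, 0 < π x) (hsum : ∑ x, π x = 1) (f : X → ℝ) :
    l1Norm π f ≤ l2Norm π f := by
  have h := sum_mul_mul_le_l2Norm hpos (fun x => |f x|) 1
  simpa [l1Norm, l2Norm, hsum] using h

theorem l1Norm_add_le (hpos : ∀ x, 0 < π x) (f g : X → ℝ) :
    l1Norm π (f + g) ≤ l1Norm π f + l1Norm π g := by
  simp only [l1Norm, ← sum_add_distrib, ← mul_add]
  exact sum_le_sum fun x _ => mul_le_mul_of_nonneg_left (abs_add_le _ _) (hpos x).le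

theorem l1Norm_smul {c : ℝ} (hc : 0 ≤ c) (f : X → ℝ) : l1Norm π (c • f) = c * l1Norm π f := by
  simp only [l1Norm, Pi.smul_apply, smul_eq_mul, abs_mul, abs_of_nonneg hc, mul_sum]
  exact sum_congr rfl fun x _ => by ring

theorem l1Norm_nonneg (hpos : ∀ x, 0 < π x) (f : X → ℝ) : 0 ≤ l1Norm π f :=
  sum_nonneg fun x _ => mul_nonneg (hpos x).le (abs_nonneg _)

theorem l1Norm_div_sub_one (hpos : ∀ x, 0 < π x) (ν : X → ℝ) :
    l1Norm π (fun x => ν x / π x - 1) = ∑ x, |π x - ν x| := by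
  refine sum_congr rfl fun x _ => ?_
  rw [abs_sub_comm (π x)]
  nth_rw 1 [← abs_of_pos (hpos x)]
  rw [← abs_mul]
  congr 1
  have := (hpos x).ne'
  field_simp

theorem sum_abs_sub_le_two {ν : X → ℝ} (hpos : ∀ x, 0 < π x) (hsum : ∑ x, π x = 1)
    (hν : ∀ x, 0 ≤ ν x) (hνsum : ∑ x, ν x = 1) : ∑ x, |π x - ν x| ≤ 2 := by
  have h : ∑ x, |π x - ν x| ≤ ∑ x, (π x + ν x) :=
    sum_le_sum fun x _ => abs_le.mpr ⟨by linarith [hpos x, hν x], by linarith [hpos x, hν x]⟩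
  rw [sum_add_distrib, hsum, hνsum] at h
  linarith

theorem l1Norm_adjointOp_le (hP : ∀ x y, 0 ≤ P x y) (hP1 : ∀ x, ∑ y, P x y = 1)
    (hpos : ∀ x, 0 < π x) (f : X → ℝ) : l1Norm π (adjointOp P π f) ≤ l1Norm π f := by
  rw [l1Norm, l1Norm, ← sum_mul_adjointOp hP1 hpos (fun x => |f x|)]
  refine sum_le_sum fun y _ => ?_
  rw [mul_adjointOp_apply hpos]
  nth_rw 1 [← abs_of_pos (hpos y)]
  rw [← abs_mul, mul_adjointOp_apply hpos]
  refine (abs_sum_le_sum_abs _ _).trans (le_of_eq (sum_congr rfl fun x _ => ?_))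
  rw [abs_mul, abs_of_nonneg (mul_nonneg (hpos x).le (hP x y))]

theorem l1Norm_adjointOp_pow_le (hP : ∀ x y, 0 ≤ P x y) (hP1 : ∀ x, ∑ y, P x y = 1)
    (hpos : ∀ x, 0 < π x) (f : X → ℝ) (n : ℕ) :
    l1Norm π ((adjointOp P π ^ n) f) ≤ l1Norm π f := by
  induction n with
  | zero => simp
  | succ n ih =>
    rw [pow_succ', Module.End.mul_apply]
    exact (l1Norm_adjointOp_le hP hP1 hpos _).trans ih

theorem l2Norm_apply_le (hP : ∀ x y, 0 ≤ P x y) (hP1 : ∀ x, ∑ y, P x y = 1)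
    (hpos : ∀ x, 0 < π x) (hstat : ∀ y, ∑ x, π x * P x y = π y) (f : X → ℝ) :
    l2Norm π (fun x => ∑ y, P x y * f y) ≤ l2Norm π f := by
  refine Real.sqrt_le_sqrt ?_
  simp only [sq_abs]
  calc ∑ x, π x * (∑ y, P x y * f y) ^ 2 ≤ ∑ x, π x * ∑ y, P x y * f y ^ 2 :=
        sum_le_sum fun x _ => mul_le_mul_of_nonneg_left
          (Real.pow_arith_mean_le_arith_mean_pow_of_even univ (P x) f (fun y _ => hP x y)
            (hP1 x) even_two) (hpos x).le
    _ = ∑ y, π y * f y ^ 2 := by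
        simp_rw [mul_sum]
        rw [sum_comm]
        refine sum_congr rfl fun y _ => ?_
        rw [← hstat y, sum_mul]
        exact sum_congr rfl fun x _ => by ring

theorem l2Norm_apply_le_of_le_specGap (hP : ∀ x y, 0 ≤ P x y) (hP1 : ∀ x, ∑ y, P x y = 1)
    (hpos : ∀ x, 0 < π x) (hstat : ∀ y, ∑ x, π x * P x y = π y) {γ : ℝ}
    (hγ : γ ≤ specGap P π) {f : X → ℝ} (hf : ∑ x, π x * f x = 0) :
    l2Norm π (fun x => ∑ y, P x y * f y) ≤ (1 - γ) * l2Norm π f := by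
  by_cases h0 : f = 0
  · simp [h0, l2Norm]
  rw [← div_le_iff₀ (l2Norm_pos hpos h0)]
  refine le_trans ?_ (le_sub_comm.mp hγ)
  refine le_csSup ⟨1, ?_⟩ ⟨f, h0, hf, rfl⟩
  rintro _ ⟨g, hg, -, rfl⟩
  exact (div_le_one (l2Norm_pos hpos hg)).mpr (l2Norm_apply_le hP hP1 hpos hstat g)

theorem l2Norm_adjointOp_le (hP : ∀ x y, 0 ≤ P x y) (hP1 : ∀ x, ∑ y, P x y = 1)
    (hpos : ∀ x, 0 < π x) (hstat : ∀ y, ∑ x, π x * P x y = π y) {γ : ℝ}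
    (hγ1 : γ ≤ 1) (hγ : γ ≤ specGap P π) {f : X → ℝ} (hf : ∑ x, π x * f x = 0) :
    l2Norm π (adjointOp P π f) ≤ (1 - γ) * l2Norm π f := by
  rcases (l2Norm_nonneg (π := π) (adjointOp P π f)).eq_or_lt with h0 | h0
  · rw [← h0]
    exact mul_nonneg (by linarith) (l2Norm_nonneg f)
  refine le_of_mul_le_mul_right ?_ h0
  have hmean : ∑ x, π x * adjointOp P π f x = 0 := by rw [sum_mul_adjointOp hP1 hpos, hf]
  calc l2Norm π (adjointOp P π f) * l2Norm π (adjointOp P π f)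
      = ∑ x, π x * (f x * ∑ y, P x y * adjointOp P π f y) := by
        rw [← sq, l2Norm_sq hpos, sum_mul_adjointOp_mul hpos]
    _ ≤ l2Norm π f * l2Norm π (fun x => ∑ y, P x y * adjointOp P π f y) :=
        sum_mul_mul_le_l2Norm hpos _ _
    _ ≤ l2Norm π f * ((1 - γ) * l2Norm π (adjointOp P π f)) :=
        mul_le_mul_of_nonneg_left
          (l2Norm_apply_le_of_le_specGap hP hP1 hpos hstat hγ hmean) (l2Norm_nonneg f)
    _ = (1 - γ) * l2Norm π f * l2Norm π (adjointOp P π f) := by ring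

theorem sum_mul_adjointOp_pow (hP1 : ∀ x, ∑ y, P x y = 1) (hpos : ∀ x, 0 < π x) (f : X → ℝ)
    (n : ℕ) : ∑ y, π y * (adjointOp P π ^ n) f y = ∑ x, π x * f x := by
  induction n with
  | zero => simp
  | succ n ih => rw [pow_succ', Module.End.mul_apply, sum_mul_adjointOp hP1 hpos, ih]

theorem l2Norm_adjointOp_pow_le (hP : ∀ x y, 0 ≤ P x y) (hP1 : ∀ x, ∑ y, P x y = 1)
    (hpos : ∀ x, 0 < π x) (hstat : ∀ y, ∑ x, π x * P x y = π y) {γ : ℝ}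
    (hγ1 : γ ≤ 1) (hγ : γ ≤ specGap P π) {f : X → ℝ} (hf : ∑ x, π x * f x = 0) (n : ℕ) :
    l2Norm π ((adjointOp P π ^ n) f) ≤ (1 - γ) ^ n * l2Norm π f := by
  induction n with
  | zero => simp
  | succ n ih =>
    rw [pow_succ', Module.End.mul_apply, pow_succ', mul_assoc]
    refine (l2Norm_adjointOp_le hP hP1 hpos hstat hγ1 hγ ?_).trans
      (mul_le_mul_of_nonneg_left ih (by linarith))
    rw [sum_mul_adjointOp_pow hP1 hpos, hf]

section FixedPoint

variable {δ : ℝ} {u v : X → ℝ}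

theorem l2Norm_le_of_fixedPoint (hP : ∀ x y, 0 ≤ P x y) (hP1 : ∀ x, ∑ y, P x y = 1)
    (hpos : ∀ x, 0 < π x) (hstat : ∀ y, ∑ x, π x * P x y = π y) {γ : ℝ} (hγ0 : 0 < γ)
    (hγ1 : γ ≤ 1) (hγ : γ ≤ specGap P π) (hδ0 : 0 ≤ δ) (hδ1 : δ ≤ 1)
    (hu : ∑ x, π x * u x = 0) (huv : u = (1 - δ) • adjointOp P π u + δ • v) :
    l2Norm π u ≤ δ / γ * l2Norm π v := by
  rcases (l2Norm_nonneg (π := π) u).eq_or_lt with h0 | h0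
  · rw [← h0]
    exact mul_nonneg (div_nonneg hδ0 hγ0.le) (l2Norm_nonneg v)
  have hsq : l2Norm π u ^ 2 =
      (1 - δ) * ∑ x, π x * (u x * adjointOp P π u x) + δ * ∑ x, π x * (u x * v x) := by
    rw [l2Norm_sq hpos, mul_sum, mul_sum, ← sum_add_distrib]
    refine sum_congr rfl fun x _ => ?_
    have hx := congrFun huv x
    simp only [Pi.add_apply, Pi.smul_apply, smul_eq_mul] at hx
    linear_combination π x * u x * hx
  have hQ : ∑ x, π x * (u x * adjointOp P π u x) ≤ (1 - γ) * l2Norm π u ^ 2 := by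
    refine (sum_mul_mul_le_l2Norm hpos _ _).trans ?_
    have := mul_le_mul_of_nonneg_left
      (l2Norm_adjointOp_le hP hP1 hpos hstat hγ1 hγ hu) h0.le
    linarith
  have hQδ : (1 - δ) * ∑ x, π x * (u x * adjointOp P π u x) ≤ (1 - γ) * l2Norm π u ^ 2 := by
    refine (mul_le_mul_of_nonneg_left hQ (by linarith)).trans ?_
    exact mul_le_of_le_one_left (mul_nonneg (by linarith) (sq_nonneg _)) (by linarith)
  have hv := mul_le_mul_of_nonneg_left (sum_mul_mul_le_l2Norm hpos u v) hδ0
  rw [div_mul_eq_mul_div, le_div_iff₀ hγ0]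
  refine le_of_mul_le_mul_right ?_ h0
  linarith

theorem l1Norm_le_of_fixedPoint (hP : ∀ x y, 0 ≤ P x y) (hP1 : ∀ x, ∑ y, P x y = 1)
    (hpos : ∀ x, 0 < π x) (hδ0 : 0 ≤ δ) (hδ1 : δ ≤ 1)
    (huv : u = (1 - δ) • adjointOp P π u + δ • v) (n : ℕ) :
    l1Norm π u ≤ n * (δ * l1Norm π v) + l1Norm π ((adjointOp P π ^ n) u) := by
  induction n with
  | zero => simp
  | succ n ih =>
    have hstep : (adjointOp P π ^ n) u =
        (1 - δ) • (adjointOp P π ^ (n + 1)) u + δ • (adjointOp P π ^ n) v := by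
      conv_lhs => rw [huv]
      rw [map_add, map_smul, map_smul, pow_succ, Module.End.mul_apply]
    have h := l1Norm_add_le hpos ((1 - δ) • (adjointOp P π ^ (n + 1)) u)
      (δ • (adjointOp P π ^ n) v)
    rw [← hstep, l1Norm_smul (by linarith), l1Norm_smul hδ0] at h
    have hv := mul_le_mul_of_nonneg_left (l1Norm_adjointOp_pow_le hP hP1 hpos v n) hδ0
    have hu := mul_nonneg hδ0 (l1Norm_nonneg hpos ((adjointOp P π ^ (n + 1)) u))
    push_cast
    linarith

end FixedPoint

theorem sum_mul_div_sub_one (hpos : ∀ x, 0 < π x) (hsum : ∑ x, π x = 1) {ν : X → ℝ}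
    (hν : ∑ x, ν x = 1) : ∑ x, π x * (ν x / π x - 1) = 0 := by
  simp_rw [mul_sub, mul_div_cancel₀ _ (hpos _).ne', sum_sub_distrib, mul_one, hsum, hν, sub_self]

theorem div_sub_one_eq_of_stationary (hpos : ∀ x, 0 < π x)
    (hstat : ∀ y, ∑ x, π x * P x y = π y) {δ : ℝ} {μ ν : X → ℝ} (hν : ∑ x, ν x = 1)
    (hνstat : ∀ y, ∑ x, ν x * ((1 - δ) * P x y + δ * μ y) = ν y) :
    (fun x => ν x / π x - 1) = (1 - δ) • adjointOp P π (fun x => ν x / π x - 1) +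
      δ • fun x => μ x / π x - 1 := by
  ext y
  refine mul_left_cancel₀ (hpos y).ne' ?_
  have hQ := mul_adjointOp_apply (P := P) hpos (fun x => ν x / π x - 1) y
  have hQ' : ∑ x, π x * P x y * (ν x / π x - 1) = ∑ x, ν x * P x y - π y := by
    rw [← hstat y, ← sum_sub_distrib]
    refine sum_congr rfl fun x _ => ?_
    have := (hpos x).ne'
    field_simp
  have hy : (1 - δ) * ∑ x, ν x * P x y + δ * μ y = ν y := by
    have hμy : δ * μ y = ∑ x, ν x * (δ * μ y) := by rw [← sum_mul, hν, one_mul]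
    rw [mul_sum, hμy, ← sum_add_distrib, ← hνstat y]
    exact sum_congr rfl fun x _ => by ring
  simp only [Pi.add_apply, Pi.smul_apply, smul_eq_mul]
  rw [hQ'] at hQ
  have hνy : π y * (ν y / π y) = ν y := mul_div_cancel₀ _ (hpos y).ne'
  have hμy : π y * (μ y / π y) = μ y := mul_div_cancel₀ _ (hpos y).ne'
  linear_combination hνy - δ * hμy - (1 - δ) * hQ - hy

theorem l2Norm_div_sub_one_le (hpos : ∀ x, 0 < π x) (hsum : ∑ x, π x = 1) {μ : X → ℝ}
    (hμ : ∀ x, 0 ≤ μ x) (hμsum : ∑ x, μ x = 1) {M : ℝ} (hM : ∀ x, μ x / π x ≤ M) :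
    l2Norm π (fun x => μ x / π x - 1) ≤ Real.sqrt M := by
  refine Real.sqrt_le_sqrt ?_
  have h : ∑ x, π x * |μ x / π x - 1| ^ 2 ≤ ∑ x, (μ x * M - 2 * μ x + π x) := by
    refine sum_le_sum fun x _ => ?_
    have h1 := mul_le_mul_of_nonneg_left (hM x) (hμ x)
    have h2 : π x * (μ x / π x) = μ x := mul_div_cancel₀ _ (hpos x).ne'
    rw [sq_abs]
    have h3 : π x * (μ x / π x - 1) ^ 2 = μ x * (μ x / π x) - 2 * μ x + π x := by
      linear_combination (μ x / π x - 2) * h2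
    linarith
  rw [sum_add_distrib, sum_sub_distrib, ← sum_mul, ← mul_sum, hsum, hμsum] at h
  linarith

theorem one_le_of_div_le (hpos : ∀ x, 0 < π x) (hsum : ∑ x, π x = 1) {μ : X → ℝ}
    (hμsum : ∑ x, μ x = 1) {M : ℝ} (hM : ∀ x, μ x / π x ≤ M) : 1 ≤ M := by
  have h : ∑ x, μ x ≤ ∑ x, M * π x := sum_le_sum fun x _ => (div_le_iff₀ (hpos x)).mp (hM x)
  rwa [← mul_sum, hsum, hμsum, mul_one] at h

theorem one_sub_pow_ceil_mul_sqrt_le_one {γ M : ℝ} (hγ0 : 0 < γ) (hγ1 : γ ≤ 1) (hM : 0 < M) :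
    (1 - γ) ^ ⌈Real.log M / (2 * γ)⌉₊ * Real.sqrt M ≤ 1 := by
  set n := ⌈Real.log M / (2 * γ)⌉₊
  have hn : Real.log M / (2 * γ) ≤ n := Nat.le_ceil _
  rw [div_le_iff₀ (by positivity)] at hn
  have h1 : (1 - γ) ^ n ≤ Real.exp (-(n * γ)) := by
    rw [← mul_neg, Real.exp_nat_mul]
    exact pow_le_pow_left₀ (by linarith) (Real.one_sub_le_exp_neg γ) n
  have h2 : Real.sqrt M ≤ Real.exp (n * γ) := by
    rw [← Real.exp_log (Real.sqrt_pos.mpr hM), Real.log_sqrt hM.le]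
    exact Real.exp_le_exp.mpr (by linarith)
  calc (1 - γ) ^ n * Real.sqrt M ≤ Real.exp (-(n * γ)) * Real.exp (n * γ) :=
        mul_le_mul h1 h2 (Real.sqrt_nonneg _) (Real.exp_nonneg _)
    _ = 1 := by rw [← Real.exp_add, neg_add_cancel, Real.exp_zero]

theorem sum_abs_sub_le_log (hP : ∀ x y, 0 ≤ P x y) (hP1 : ∀ x, ∑ y, P x y = 1)
    (hpos : ∀ x, 0 < π x) (hsum : ∑ x, π x = 1) (hstat : ∀ y, ∑ x, π x * P x y = π y)
    {γ : ℝ} (hγ0 : 0 < γ) (hγ1 : γ ≤ 1) (hγ : γ ≤ specGap P π)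
    {μ : X → ℝ} (hμ : ∀ x, 0 ≤ μ x) (hμsum : ∑ x, μ x = 1)
    {δ : ℝ} (hδ0 : 0 ≤ δ) (hδ1 : δ ≤ 1) {ν : X → ℝ} (hν : ∑ x, ν x = 1)
    (hνstat : ∀ y, ∑ x, ν x * ((1 - δ) * P x y + δ * μ y) = ν y)
    {M : ℝ} (hM : ∀ x, μ x / π x ≤ M) :
    ∑ x, |π x - ν x| ≤ δ / γ * (3 + Real.log M) := by
  have hM1 := one_le_of_div_le hpos hsum hμsum hM
  have huv := div_sub_one_eq_of_stationary hpos hstat hν hνstat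
  have hu := sum_mul_div_sub_one hpos hsum hν
  set n := ⌈Real.log M / (2 * γ)⌉₊ with hn
  have h1 := l1Norm_le_of_fixedPoint hP hP1 hpos hδ0 hδ1 huv n
  rw [l1Norm_div_sub_one hpos, l1Norm_div_sub_one hpos] at h1
  have hlog := Real.log_nonneg hM1
  have hnle : (n : ℝ) ≤ (Real.log M / 2 + 1) / γ := by
    calc (n : ℝ) ≤ Real.log M / (2 * γ) + 1 := (Nat.ceil_lt_add_one (by positivity)).le
      _ ≤ Real.log M / (2 * γ) + 1 / γ := by
        gcongr
        exact (one_le_div hγ0).mpr hγ1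
      _ = _ := by field_simp
  have hmain : n * (δ * ∑ x, |π x - μ x|) ≤ (Real.log M / 2 + 1) / γ * (δ * 2) := by
    have := sum_abs_sub_le_two hpos hsum hμ hμsum
    gcongr
  have htail : l1Norm π ((adjointOp P π ^ n) fun x => ν x / π x - 1) ≤ δ / γ := by
    have hpow : 0 ≤ (1 - γ) ^ n := pow_nonneg (by linarith) n
    calc _ ≤ l2Norm π ((adjointOp P π ^ n) fun x => ν x / π x - 1) :=
          l1Norm_le_l2Norm hpos hsum _
      _ ≤ (1 - γ) ^ n * l2Norm π (fun x => ν x / π x - 1) :=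
          l2Norm_adjointOp_pow_le hP hP1 hpos hstat hγ1 hγ hu n
      _ ≤ (1 - γ) ^ n * (δ / γ * Real.sqrt M) := by
          refine mul_le_mul_of_nonneg_left ?_ hpow
          exact (l2Norm_le_of_fixedPoint hP hP1 hpos hstat hγ0 hγ1 hγ hδ0 hδ1 hu huv).trans
            (mul_le_mul_of_nonneg_left (l2Norm_div_sub_one_le hpos hsum hμ hμsum hM)
              (by positivity))
      _ = δ / γ * ((1 - γ) ^ n * Real.sqrt M) := by ring
      _ ≤ δ / γ := mul_le_of_le_one_right (by positivity)
          (one_sub_pow_ceil_mul_sqrt_le_one hγ0 hγ1 (by linarith))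
  calc ∑ x, |π x - ν x| ≤ (Real.log M / 2 + 1) / γ * (δ * 2) + δ / γ := by linarith
    _ = δ / γ * (3 + Real.log M) := by ring

end PageRank

/-- There is an absolute constant `C > 0` such that for any chain
`P` with positive stationary distribution `π` and spectral gap at least
`γ ∈ (0,1]`, any restart distribution `μ` and any `δ ∈ (0,1]`, the stationary
distribution `π_δ` of the PageRank chain satisfies
`‖π − π_δ‖₁ ≤ C (δ/γ) (1 + log(1 + γ‖μ/π‖_∞/δ))`. -/
theorem pagerank_close_to_pi :
    ∃ C : ℝ, 0 < C ∧
      ∀ (X : Type) [Fintype X] [Nonempty X]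
        (P : X → X → ℝ) (π : X → ℝ),
        (∀ x y, 0 ≤ P x y) → (∀ x, ∑ y, P x y = 1) →
        (∀ x, 0 < π x) → (∑ x, π x = 1) →
        (∀ y, ∑ x, π x * P x y = π y) →
        ∀ γ : ℝ, 0 < γ → γ ≤ 1 → γ ≤ specGap P π →
        ∀ μ : X → ℝ, (∀ x, 0 ≤ μ x) → (∑ x, μ x = 1) →
        ∀ δ : ℝ, 0 < δ → δ ≤ 1 →
        ∀ πδ : X → ℝ, (∀ x, 0 ≤ πδ x) → (∑ x, πδ x = 1) →
        (∀ y, ∑ x, πδ x * ((1 - δ) * P x y + δ * μ y) = πδ y) →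
        ∑ x, |π x - πδ x| ≤
          C * (δ / γ) * (1 + Real.log (1 + γ * (⨆ x, μ x / π x) / δ)) := by
  refine ⟨3, by norm_num, ?_⟩
  intro X _ _ P π hP hP1 hpos hsum hstat γ hγ0 hγ1 hγ μ hμ hμsum δ hδ0 hδ1 ν hν0 hν hνstat
  have hM : ∀ x, μ x / π x ≤ ⨆ x, μ x / π x := le_ciSup (Set.finite_range _).bddAbove
  set M := ⨆ x, μ x / π x
  have hM1 := PageRank.one_le_of_div_le hpos hsum hμsum hM
  rcases le_total γ δ with h | h
  · have hlog : 0 ≤ Real.log (1 + γ * M / δ) := Real.log_nonneg (by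
      have : 0 ≤ γ * M / δ := by positivity
      linarith)
    have hratio : 1 ≤ δ / γ := (one_le_div hγ0).mpr h
    have := PageRank.sum_abs_sub_le_two hpos hsum hν0 hν
    nlinarith [mul_nonneg (zero_le_one.trans hratio) hlog]
  · have hMle : M ≤ 1 + γ * M / δ := by
      have : M ≤ γ * M / δ := by
        rw [le_div_iff₀ hδ0, mul_comm]
        gcongr
      linarith
    have hlog := Real.log_le_log (by linarith) hMle
    have hlog0 := Real.log_nonneg hM1
    refine (PageRank.sum_abs_sub_le_log hP hP1 hpos hsum hstat hγ0 hγ1 hγ hμ hμsum hδ0.le hδ1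
      hν hνstat hM).trans ?_
    rw [mul_comm 3, mul_assoc]
    gcongr
    linarith
end

section
/- Let X be a nonempty finite set, let P be a Markov transition matrix on X with stationary distribution π satisfying π(x) > 0 for all x, and let P̃ be an ε-corruption of P, i.e., Σ_{x,y} π(x) |P(x,y) − P̃(x,y)| ≤ ε. Let p > 1 with dual exponent q (1/p + 1/q = 1), let μ be a distribution on X, let δ ∈ (0,1], and let π_δ be the unique stationary distribution of the PageRank chain P(δ)(x,y) := (1−δ) P(x,y) + δ μ(y). Then Σ_{x,y} π_δ(x) |P(x,y) − P̃(x,y)| ≤ 2 ε^{1/q} ‖μ/π‖_{p,π}, where ‖f‖_{p,π} := (Σ_x π(x)|f(x)|^p)^{1/p} and (μ/π)(x) := μ(x)/π(x). -/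
open Finset

/-- Hölder's inequality for finite sums with a positive weight. -/
theorem weighted_inner_le_Lp_mul_Lq {ι : Type*} (s : Finset ι) {p q : ℝ}
    (hpq : p.HolderConjugate q) (w f g : ι → ℝ) (hw : ∀ i, 0 < w i)
    (hf : ∀ i, 0 ≤ f i) (hg : ∀ i, 0 ≤ g i) :
    ∑ i ∈ s, w i * (f i * g i) ≤
      (∑ i ∈ s, w i * f i ^ p) ^ (1 / p) * (∑ i ∈ s, w i * g i ^ q) ^ (1 / q) := by
  have h := Real.inner_le_Lp_mul_Lq_of_nonneg s hpq
    (f := fun i => w i ^ (1 / p) * f i) (g := fun i => w i ^ (1 / q) * g i)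
    (fun i _ => mul_nonneg (Real.rpow_nonneg (hw i).le _) (hf i))
    (fun i _ => mul_nonneg (Real.rpow_nonneg (hw i).le _) (hg i))
  have hpow (r : ℝ) (hr : r ≠ 0) (u : ι → ℝ) (hu : ∀ i, 0 ≤ u i) (i : ι) :
      (w i ^ (1 / r) * u i) ^ r = w i * u i ^ r := by
    rw [Real.mul_rpow (Real.rpow_nonneg (hw i).le _) (hu i), ← Real.rpow_mul (hw i).le,
      one_div_mul_cancel hr, Real.rpow_one]
  have hsplit (i : ι) : w i ^ (1 / p) * f i * (w i ^ (1 / q) * g i) = w i * (f i * g i) := by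
    have hw1 : w i ^ (1 / p) * w i ^ (1 / q) = w i := by
      rw [← Real.rpow_add (hw i), one_div, one_div, hpq.inv_add_inv_eq_one, Real.rpow_one]
    linear_combination (f i * g i) * hw1
  simpa only [hsplit, hpow p hpq.ne_zero f hf, hpow q hpq.symm.ne_zero g hg] using h

/-- The time reversal of a Markov chain is a contraction of `L^p` of its stationary
distribution. -/
theorem sum_mul_reversal_rpow_le {X : Type*} [Fintype X] (P : X → X → ℝ) (π : X → ℝ)
    (hP0 : ∀ x y, 0 ≤ P x y) (hP1 : ∀ x, ∑ y, P x y = 1) (hπ0 : ∀ x, 0 < π x)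
    (hstat : ∀ y, ∑ x, π x * P x y = π y) {p : ℝ} (hp : 1 ≤ p)
    (f : X → ℝ) (hf : ∀ x, 0 ≤ f x) :
    ∑ y, π y * (∑ x, π x * P x y / π y * f x) ^ p ≤ ∑ x, π x * f x ^ p := by
  calc ∑ y, π y * (∑ x, π x * P x y / π y * f x) ^ p
      ≤ ∑ y, π y * ∑ x, π x * P x y / π y * f x ^ p := by
        refine sum_le_sum fun y _ => mul_le_mul_of_nonneg_left ?_ (hπ0 y).le
        refine Real.rpow_arith_mean_le_arith_mean_rpow univ _ _
          (fun x _ => div_nonneg (mul_nonneg (hπ0 x).le (hP0 x y)) (hπ0 y).le) ?_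
          (fun x _ => hf x) hp
        rw [← sum_div, hstat, div_self (hπ0 y).ne']
    _ = ∑ y, ∑ x, π x * f x ^ p * P x y := by
        refine sum_congr rfl fun y _ => ?_
        rw [mul_sum]
        refine sum_congr rfl fun x _ => ?_
        have := (hπ0 y).ne'
        field_simp
    _ = ∑ x, π x * f x ^ p := by
        rw [sum_comm]
        simp only [← mul_sum, hP1, mul_one]

/-- The density of the PageRank distribution has at most the `L^p` norm of the density of the
restart distribution. -/
theorem sum_mul_pagerank_density_rpow_le {X : Type*} [Fintype X] (P : X → X → ℝ) (π : X → ℝ)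
    (hP0 : ∀ x y, 0 ≤ P x y) (hP1 : ∀ x, ∑ y, P x y = 1) (hπ0 : ∀ x, 0 < π x)
    (hstat : ∀ y, ∑ x, π x * P x y = π y) {p : ℝ} (hp : 1 ≤ p)
    (μ : X → ℝ) (hμ0 : ∀ x, 0 ≤ μ x) {δ : ℝ} (hδ0 : 0 < δ) (hδ1 : δ ≤ 1)
    (πδ : X → ℝ) (hπδ0 : ∀ x, 0 ≤ πδ x) (hπδ1 : ∑ x, πδ x = 1)
    (hπδstat : ∀ y, ∑ x, πδ x * ((1 - δ) * P x y + δ * μ y) = πδ y) :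
    ∑ x, π x * (πδ x / π x) ^ p ≤ ∑ x, π x * (μ x / π x) ^ p := by
  have hfix (y : X) : πδ y / π y =
      (1 - δ) * ∑ x, π x * P x y / π y * (πδ x / π x) + δ * (μ y / π y) := by
    have h : πδ y = (1 - δ) * ∑ x, πδ x * P x y + δ * μ y := by
      rw [← hπδstat y]
      simp only [mul_add, sum_add_distrib, ← sum_mul, hπδ1, one_mul]
      simp only [mul_sum, mul_left_comm]
    have hsum : ∑ x, π x * P x y / π y * (πδ x / π x) = (∑ x, πδ x * P x y) / π y := by
      rw [sum_div]
      refine sum_congr rfl fun x _ => ?_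
      have := (hπ0 x).ne'
      field_simp
    rw [hsum]
    nth_rewrite 1 [h]
    ring
  have hf (x : X) : 0 ≤ πδ x / π x := div_nonneg (hπδ0 x) (hπ0 x).le
  have hconv (y : X) : π y * (πδ y / π y) ^ p ≤
      (1 - δ) * (π y * (∑ x, π x * P x y / π y * (πδ x / π x)) ^ p) +
        δ * (π y * (μ y / π y) ^ p) := by
    have h := (convexOn_rpow hp).2
      (Set.mem_Ici.2 (sum_nonneg (s := univ) fun x _ =>
        mul_nonneg (div_nonneg (mul_nonneg (hπ0 x).le (hP0 x y)) (hπ0 y).le) (hf x)))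
      (Set.mem_Ici.2 (div_nonneg (hμ0 y) (hπ0 y).le))
      (sub_nonneg.2 hδ1) hδ0.le (sub_add_cancel 1 δ)
    simp only [smul_eq_mul] at h
    rw [← hfix y] at h
    linarith [mul_le_mul_of_nonneg_left h (hπ0 y).le]
  have hsum := sum_le_sum fun y (_ : y ∈ univ) => hconv y
  rw [sum_add_distrib, ← mul_sum, ← mul_sum] at hsum
  have hcontr := mul_le_mul_of_nonneg_left
    (sum_mul_reversal_rpow_le P π hP0 hP1 hπ0 hstat hp _ hf) (sub_nonneg.2 hδ1)
  refine le_of_mul_le_mul_left ?_ hδ0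
  linarith

/-- The row-wise `ℓ¹` distance of two Markov transition matrices is at most `2`. -/
theorem sum_abs_sub_le_two {X : Type*} [Fintype X] (a b : X → ℝ) (ha0 : ∀ y, 0 ≤ a y)
    (ha1 : ∑ y, a y = 1) (hb0 : ∀ y, 0 ≤ b y) (hb1 : ∑ y, b y = 1) :
    ∑ y, |a y - b y| ≤ 2 := by
  calc ∑ y, |a y - b y| ≤ ∑ y, (a y + b y) := sum_le_sum fun y _ =>
        abs_le.2 ⟨by linarith [ha0 y, hb0 y], by linarith [ha0 y, hb0 y]⟩
    _ = 2 := by rw [sum_add_distrib, ha1, hb1]; norm_num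

/-- Interpolation of a weighted `L^q` norm between `L¹` and a uniform bound `c ≥ 1`. -/
theorem weighted_Lq_le_of_le {ι : Type*} (s : Finset ι) {q c ε : ℝ} (hq : 1 ≤ q) (hc : 1 ≤ c)
    (w d : ι → ℝ) (hw : ∀ i, 0 ≤ w i) (hd0 : ∀ i, 0 ≤ d i) (hdc : ∀ i, d i ≤ c)
    (hε : ∑ i ∈ s, w i * d i ≤ ε) :
    (∑ i ∈ s, w i * d i ^ q) ^ (1 / q) ≤ c * ε ^ (1 / q) := by
  have hc0 : 0 ≤ c := by linarith
  have hq0 : 0 < q := by linarith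
  have hε0 : 0 ≤ ε := (sum_nonneg fun i _ => mul_nonneg (hw i) (hd0 i)).trans hε
  have hpow (i : ι) : d i ^ q ≤ c ^ q * d i := by
    have hsplit : d i ^ q = d i ^ (q - 1) * d i := by
      rw [← Real.rpow_add_one' (hd0 i) (by linarith), sub_add_cancel]
    rw [hsplit]
    refine mul_le_mul_of_nonneg_right ?_ (hd0 i)
    exact (Real.rpow_le_rpow (hd0 i) (hdc i) (by linarith)).trans
      (Real.rpow_le_rpow_of_exponent_le hc (by linarith))
  have hsum : ∑ i ∈ s, w i * d i ^ q ≤ c ^ q * ε := by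
    calc ∑ i ∈ s, w i * d i ^ q ≤ ∑ i ∈ s, c ^ q * (w i * d i) := sum_le_sum fun i _ => by
          linarith [mul_le_mul_of_nonneg_left (hpow i) (hw i)]
      _ ≤ c ^ q * ε := by
          rw [← mul_sum]
          exact mul_le_mul_of_nonneg_left hε (Real.rpow_nonneg hc0 _)
  calc (∑ i ∈ s, w i * d i ^ q) ^ (1 / q) ≤ (c ^ q * ε) ^ (1 / q) :=
        Real.rpow_le_rpow (sum_nonneg fun i _ => mul_nonneg (hw i) (Real.rpow_nonneg (hd0 i) _))
          hsum (by positivity)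
    _ = c * ε ^ (1 / q) := by
        rw [Real.mul_rpow (Real.rpow_nonneg hc0 _) hε0, ← Real.rpow_mul hc0,
          mul_one_div_cancel hq0.ne', Real.rpow_one]

/-- If `P̃` is an `ε`-corruption of `P` (with respect to the
positive stationary distribution `π` of `P`), `1/p + 1/q = 1` with `p > 1`, and
`π_δ` is the stationary distribution of the PageRank chain `(1−δ)P + δ𝟙ᵀμ`,
then `Σ_{x,y} π_δ(x) |P(x,y) − P̃(x,y)| ≤ 2 ε^{1/q} ‖μ/π‖_{p,π}`. -/
theorem corruption_weighted_by_pagerank {X : Type*} [Fintype X] [Nonempty X]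
    (P Pt : X → X → ℝ) (π : X → ℝ) (ε : ℝ)
    (hP0 : ∀ x y, 0 ≤ P x y) (hP1 : ∀ x, ∑ y, P x y = 1)
    (hPt0 : ∀ x y, 0 ≤ Pt x y) (hPt1 : ∀ x, ∑ y, Pt x y = 1)
    (hπ0 : ∀ x, 0 < π x) (hπ1 : ∑ x, π x = 1)
    (hstat : ∀ y, ∑ x, π x * P x y = π y)
    (hcorr : ∑ x, ∑ y, π x * |P x y - Pt x y| ≤ ε)
    (p q : ℝ) (hp : 1 < p) (hpq : 1 / p + 1 / q = 1)
    (μ : X → ℝ) (hμ0 : ∀ x, 0 ≤ μ x) (hμ1 : ∑ x, μ x = 1)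
    (δ : ℝ) (hδ0 : 0 < δ) (hδ1 : δ ≤ 1)
    (πδ : X → ℝ) (hπδ0 : ∀ x, 0 ≤ πδ x) (hπδ1 : ∑ x, πδ x = 1)
    (hπδstat : ∀ y, ∑ x, πδ x * ((1 - δ) * P x y + δ * μ y) = πδ y) :
    ∑ x, ∑ y, πδ x * |P x y - Pt x y| ≤
      2 * ε ^ (1 / q) * (∑ x, π x * |μ x / π x| ^ p) ^ (1 / p) := by
  have hconj : p.HolderConjugate q :=
    Real.holderConjugate_iff.2 ⟨hp, by simpa only [one_div] using hpq⟩
  have hd0 (x : X) : 0 ≤ ∑ y, |P x y - Pt x y| := sum_nonneg fun y _ => abs_nonneg _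
  have hd2 (x : X) : ∑ y, |P x y - Pt x y| ≤ 2 :=
    sum_abs_sub_le_two _ _ (hP0 x) (hP1 x) (hPt0 x) (hPt1 x)
  have hf (x : X) : 0 ≤ πδ x / π x := div_nonneg (hπδ0 x) (hπ0 x).le
  have habs (x : X) : |μ x / π x| = μ x / π x := abs_of_nonneg (div_nonneg (hμ0 x) (hπ0 x).le)
  simp only [← mul_sum] at hcorr
  simp only [← mul_sum, habs]
  calc ∑ x, πδ x * ∑ y, |P x y - Pt x y|
      = ∑ x, π x * (πδ x / π x * ∑ y, |P x y - Pt x y|) := by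
        refine sum_congr rfl fun x _ => ?_
        rw [← mul_assoc, mul_div_cancel₀ _ (hπ0 x).ne']
    _ ≤ (∑ x, π x * (πδ x / π x) ^ p) ^ (1 / p) *
          (∑ x, π x * (∑ y, |P x y - Pt x y|) ^ q) ^ (1 / q) :=
        weighted_inner_le_Lp_mul_Lq univ hconj π _ _ hπ0 hf hd0
    _ ≤ (∑ x, π x * (μ x / π x) ^ p) ^ (1 / p) * (2 * ε ^ (1 / q)) := by
        refine mul_le_mul ?_ ?_ ?_ ?_
        · exact Real.rpow_le_rpow
            (sum_nonneg fun x _ => mul_nonneg (hπ0 x).le (Real.rpow_nonneg (hf x) _))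
            (sum_mul_pagerank_density_rpow_le P π hP0 hP1 hπ0 hstat hp.le μ hμ0 hδ0 hδ1
              πδ hπδ0 hπδ1 hπδstat) (one_div_nonneg.2 (by linarith))
        · exact weighted_Lq_le_of_le univ hconj.symm.lt.le one_le_two π _
            (fun x => (hπ0 x).le) hd0 hd2 hcorr
        · exact Real.rpow_nonneg
            (sum_nonneg fun x _ => mul_nonneg (hπ0 x).le (Real.rpow_nonneg (hd0 x) _)) _
        · exact Real.rpow_nonneg (sum_nonneg fun x _ => mul_nonneg (hπ0 x).le
            (Real.rpow_nonneg (div_nonneg (hμ0 x) (hπ0 x).le) _)) _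
    _ = 2 * ε ^ (1 / q) * (∑ x, π x * (μ x / π x) ^ p) ^ (1 / p) := mul_comm _ _
end

section
/- There exists an absolute constant C > 0 with the following property. Let X be a nonempty finite set, let P be a Markov transition matrix on X with stationary distribution π satisfying π(x) > 0 for all x, and let P̃ be an ε-corruption of P for some ε ∈ (0,1). Let p > 1 with dual exponent q (1/p + 1/q = 1), and suppose the restart distribution μ is (β,p)-smooth with respect to π, i.e., ‖μ/π‖_{p,π} ≤ β. For δ ∈ (0,1], let π_δ and π̃_δ denote the unique stationary distributions of the PageRank chains P(δ)(x,y) := (1−δ)P(x,y) + δμ(y) and P̃(δ)(x,y) := (1−δ)P̃(x,y) + δμ(y), respectively. Then ‖π_δ − π̃_δ‖₁ ≤ C · ε^{1/q} · (1 + log(1/ε)) · β / δ, where ‖ν‖₁ := Σ_x |ν(x)|. -/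
open Finset

/-- If `ν` is stationary for the chain `(1 - δ) P + δ 𝟙ᵀ μ` and `π` is stationary for `P`, then
the `p`-th moment of the density `ν / π` is at most that of `μ / π`. -/
theorem sum_density_rpow_pagerank_le {X : Type*} [Fintype X] {P : X → X → ℝ} {π μ ν : X → ℝ}
    {p δ : ℝ} (hP : ∀ x y, 0 ≤ P x y) (hP1 : ∀ x, ∑ y, P x y = 1) (hπ : ∀ x, 0 < π x)
    (hπP : ∀ y, ∑ x, π x * P x y = π y) (hp : 1 ≤ p) (hμ : ∀ x, 0 ≤ μ x)
    (hδ : 0 < δ) (hδ1 : δ ≤ 1) (hν : ∀ x, 0 ≤ ν x) (hν1 : ∑ x, ν x = 1)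
    (hνP : ∀ y, ∑ x, ν x * ((1 - δ) * P x y + δ * μ y) = ν y) :
    ∑ x, π x * (ν x / π x) ^ p ≤ ∑ x, π x * (μ x / π x) ^ p := by
  have hδ' : 0 ≤ 1 - δ := by linarith
  have hf : ∀ x, 0 ≤ ν x / π x := fun x => div_nonneg (hν x) (hπ x).le
  have hg : ∀ x, 0 ≤ μ x / π x := fun x => div_nonneg (hμ x) (hπ x).le
  have pointwise : ∀ y, π y * (ν y / π y) ^ p ≤
      (1 - δ) * ∑ x, π x * P x y * (ν x / π x) ^ p + δ * (π y * (μ y / π y) ^ p) := by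
    intro y
    have hy := (hπ y).ne'
    have hw : ∑ x, π x * P x y / π y = 1 := by
      rw [← Finset.sum_div, hπP, div_self hy]
    have hw0 : ∀ x, 0 ≤ π x * P x y / π y := fun x =>
      div_nonneg (mul_nonneg (hπ x).le (hP x y)) (hπ y).le
    have inner := Real.rpow_arith_mean_le_arith_mean_rpow univ (fun x => π x * P x y / π y)
      (fun x => ν x / π x) (fun x _ => hw0 x) hw (fun x _ => hf x) hp
    have outer := (convexOn_rpow hp).2
      (Set.mem_Ici.2 (Finset.sum_nonneg fun x _ => mul_nonneg (hw0 x) (hf x) :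
        0 ≤ ∑ x, π x * P x y / π y * (ν x / π x)))
      (Set.mem_Ici.2 (hg y)) hδ' hδ.le (by ring)
    simp only [smul_eq_mul] at outer
    have hsum : ∑ x, π x * P x y / π y * (ν x / π x) = (∑ x, ν x * P x y) / π y := by
      rw [Finset.sum_div]
      refine Finset.sum_congr rfl fun x _ => ?_
      have := (hπ x).ne'
      field_simp
    have hdens : (1 - δ) * (∑ x, π x * P x y / π y * (ν x / π x)) + δ * (μ y / π y)
        = ν y / π y := by
      have hstat : (1 - δ) * ∑ x, ν x * P x y + δ * μ y = ν y := by
        conv_rhs => rw [← hνP y]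
        simp only [mul_add, Finset.sum_add_distrib]
        rw [← Finset.sum_mul, hν1, one_mul, Finset.mul_sum]
        simp only [mul_left_comm]
      rw [hsum, ← hstat]
      ring
    rw [hdens] at outer
    calc π y * (ν y / π y) ^ p
        ≤ π y * ((1 - δ) * ∑ x, π x * P x y / π y * (ν x / π x) ^ p
            + δ * (μ y / π y) ^ p) :=
          mul_le_mul_of_nonneg_left
            (outer.trans (by gcongr)) (hπ y).le
      _ = _ := by
          have : ∑ x, π x * P x y / π y * (ν x / π x) ^ p
              = (∑ x, π x * P x y * (ν x / π x) ^ p) / π y := by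
            rw [Finset.sum_div]
            exact Finset.sum_congr rfl fun x _ => by ring
          rw [this]
          field_simp
  have total := Finset.sum_le_sum fun y (_ : y ∈ univ) => pointwise y
  have hswap : ∑ y, ∑ x, π x * P x y * (ν x / π x) ^ p = ∑ x, π x * (ν x / π x) ^ p := by
    rw [Finset.sum_comm]
    refine Finset.sum_congr rfl fun x _ => ?_
    rw [← Finset.sum_mul, ← Finset.mul_sum, hP1, mul_one]
  rw [Finset.sum_add_distrib, ← Finset.mul_sum, ← Finset.mul_sum, hswap] at total
  nlinarith

/-- The distance between the stationary distributions of two PageRank chains with the same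
restart distribution, in terms of the discrepancy of the transition matrices. -/
theorem mul_sum_abs_sub_pagerank_le {X : Type*} [Fintype X] {P Q : X → X → ℝ} {μ ν ρ : X → ℝ}
    {δ : ℝ} (hQ : ∀ x y, 0 ≤ Q x y) (hQ1 : ∀ x, ∑ y, Q x y = 1)
    (hδ : 0 ≤ δ) (hδ1 : δ ≤ 1) (hν : ∀ x, 0 ≤ ν x) (hν1 : ∑ x, ν x = 1)
    (hνP : ∀ y, ∑ x, ν x * ((1 - δ) * P x y + δ * μ y) = ν y) (hρ1 : ∑ x, ρ x = 1)
    (hρQ : ∀ y, ∑ x, ρ x * ((1 - δ) * Q x y + δ * μ y) = ρ y) :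
    δ * ∑ x, |ν x - ρ x| ≤ ∑ x, ν x * ∑ y, |P x y - Q x y| := by
  have hδ' : 0 ≤ 1 - δ := by linarith
  have pointwise : ∀ y, |ν y - ρ y| ≤
      (1 - δ) * ∑ x, (ν x * |P x y - Q x y| + |ν x - ρ x| * Q x y) := by
    intro y
    have hdiff : ν y - ρ y =
        (1 - δ) * ∑ x, (ν x * (P x y - Q x y) + (ν x - ρ x) * Q x y) := by
      have hmass : ∑ x, (ν x - ρ x) * (δ * μ y) = 0 := by
        rw [← Finset.sum_mul, Finset.sum_sub_distrib, hν1, hρ1, sub_self, zero_mul]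
      rw [← hνP y, ← hρQ y, ← Finset.sum_sub_distrib, Finset.mul_sum, ← sub_eq_zero,
        ← Finset.sum_sub_distrib, ← hmass]
      exact Finset.sum_congr rfl fun x _ => by ring
    rw [hdiff, abs_mul, abs_of_nonneg hδ']
    refine mul_le_mul_of_nonneg_left ((Finset.abs_sum_le_sum_abs _ _).trans ?_) hδ'
    refine Finset.sum_le_sum fun x _ => (abs_add_le _ _).trans_eq ?_
    rw [abs_mul, abs_mul, abs_of_nonneg (hν x), abs_of_nonneg (hQ x y)]
  have total := Finset.sum_le_sum fun y (_ : y ∈ univ) => pointwise y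
  rw [← Finset.mul_sum, Finset.sum_comm] at total
  simp only [Finset.sum_add_distrib, ← Finset.mul_sum, hQ1, mul_one] at total
  have hS : 0 ≤ ∑ x, ν x * ∑ y, |P x y - Q x y| :=
    Finset.sum_nonneg fun x _ =>
      mul_nonneg (hν x) (Finset.sum_nonneg fun y _ => abs_nonneg _)
  nlinarith

/-- There is an absolute constant `C > 0` such that if `P̃` is
an `ε`-corruption of `P` (with positive stationary distribution `π`), `p > 1`
with dual exponent `q`, and `μ` is `(β,p)`-smooth w.r.t. `π`, then for any
`δ ∈ (0,1]` the stationary distributions `π_δ`, `π̃_δ` of the PageRank chains of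
`P` and `P̃` satisfy `‖π_δ − π̃_δ‖₁ ≤ C ε^{1/q} (1 + log(1/ε)) β / δ`. -/
theorem corrupted_pagerank_close :
    ∃ C : ℝ, 0 < C ∧
      ∀ (X : Type) [Fintype X] [Nonempty X]
        (P Pt : X → X → ℝ) (π : X → ℝ) (ε : ℝ),
        (∀ x y, 0 ≤ P x y) → (∀ x, ∑ y, P x y = 1) →
        (∀ x y, 0 ≤ Pt x y) → (∀ x, ∑ y, Pt x y = 1) →
        (∀ x, 0 < π x) → (∑ x, π x = 1) →
        (∀ y, ∑ x, π x * P x y = π y) →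
        0 < ε → ε < 1 →
        (∑ x, ∑ y, π x * |P x y - Pt x y| ≤ ε) →
        ∀ p q β : ℝ, 1 < p → 1 / p + 1 / q = 1 →
        ∀ μ : X → ℝ, (∀ x, 0 ≤ μ x) → (∑ x, μ x = 1) →
        ((∑ x, π x * |μ x / π x| ^ p) ^ (1 / p) ≤ β) →
        ∀ δ : ℝ, 0 < δ → δ ≤ 1 →
        ∀ πδ : X → ℝ, (∀ x, 0 ≤ πδ x) → (∑ x, πδ x = 1) →
        (∀ y, ∑ x, πδ x * ((1 - δ) * P x y + δ * μ y) = πδ y) →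
        ∀ πtδ : X → ℝ, (∀ x, 0 ≤ πtδ x) → (∑ x, πtδ x = 1) →
        (∀ y, ∑ x, πtδ x * ((1 - δ) * Pt x y + δ * μ y) = πtδ y) →
        ∑ x, |πδ x - πtδ x| ≤ C * ε ^ (1 / q) * (1 + Real.log (1 / ε)) * β / δ := by
  refine ⟨2, two_pos, ?_⟩
  intro X _ _ P Pt π ε hP hP1 hPt hPt1 hπ hπ1 hπP hε hε1 hPPt p q β hp hpq μ hμ hμ1 hβ δ hδ hδ1
    ν hν hν1 hνP ρ hρ hρ1 hρP
  have hp0 : 0 < p := by linarith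
  set d : X → ℝ := fun x => ∑ y, |P x y - Pt x y| with hd
  have hd0 : ∀ x, 0 ≤ d x := fun x => Finset.sum_nonneg fun y _ => abs_nonneg _
  have hd2 : ∀ x, d x ≤ 2 := by
    intro x
    calc d x ≤ ∑ y, (P x y + Pt x y) := Finset.sum_le_sum fun y _ =>
          (abs_sub _ _).trans_eq (by rw [abs_of_nonneg (hP x y), abs_of_nonneg (hPt x y)])
      _ = 2 := by rw [Finset.sum_add_distrib, hP1, hPt1]; norm_num
  have hf : ∀ x, 0 ≤ ν x / π x := fun x => div_nonneg (hν x) (hπ x).le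
  have hdε : ∑ x, π x * d x ≤ ε := by simpa only [hd, Finset.mul_sum] using hPPt
  have hq : 1 - p⁻¹ = 1 / q := by rw [inv_eq_one_div]; linarith
  have hq0 : 0 ≤ 1 / q := by
    rw [← hq]
    linarith [inv_le_one_of_one_le₀ hp.le]
  have hdist := mul_sum_abs_sub_pagerank_le hPt hPt1 hδ.le hδ1 hν hν1 hνP hρ1 hρP
  have holder := Real.inner_le_weight_mul_Lp_of_nonneg univ hp.le
    (fun x => π x * d x) (fun x => ν x / π x) (fun x => mul_nonneg (hπ x).le (hd0 x)) hf
  have hweight : ∑ x, π x * d x * (ν x / π x) = ∑ x, ν x * d x :=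
    Finset.sum_congr rfl fun x _ => by
      have := (hπ x).ne'
      field_simp
  have hmoment : (∑ x, π x * d x * (ν x / π x) ^ p) ^ p⁻¹ ≤ 2 * β := by
    have hμβ : (∑ x, π x * (μ x / π x) ^ p) ^ p⁻¹ ≤ β := by
      rw [← one_div]
      refine le_of_eq_of_le ?_ hβ
      simp only [abs_of_nonneg (div_nonneg (hμ _) (hπ _).le)]
    have hμ0 : 0 ≤ ∑ x, π x * (μ x / π x) ^ p := Finset.sum_nonneg fun x _ =>
      mul_nonneg (hπ x).le (Real.rpow_nonneg (div_nonneg (hμ x) (hπ x).le) _)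
    calc (∑ x, π x * d x * (ν x / π x) ^ p) ^ p⁻¹
        ≤ (2 * ∑ x, π x * (μ x / π x) ^ p) ^ p⁻¹ := by
          refine Real.rpow_le_rpow (Finset.sum_nonneg fun x _ => mul_nonneg
            (mul_nonneg (hπ x).le (hd0 x)) (Real.rpow_nonneg (hf x) _)) ?_ (by positivity)
          refine le_trans ?_ (mul_le_mul_of_nonneg_left
            (sum_density_rpow_pagerank_le hP hP1 hπ hπP hp.le hμ hδ hδ1 hν hν1 hνP) two_pos.le)
          rw [Finset.mul_sum]
          refine Finset.sum_le_sum fun x _ => ?_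
          have := mul_le_mul_of_nonneg_right (hd2 x)
            (mul_nonneg (hπ x).le (Real.rpow_nonneg (hf x) p))
          linarith
      _ = 2 ^ p⁻¹ * (∑ x, π x * (μ x / π x) ^ p) ^ p⁻¹ := Real.mul_rpow two_pos.le hμ0
      _ ≤ 2 * β := by
          refine mul_le_mul ?_ hμβ (Real.rpow_nonneg hμ0 _) two_pos.le
          exact Real.rpow_le_self_of_one_le one_le_two (inv_le_one_of_one_le₀ hp.le)
  have hβ0 : 0 ≤ β := le_trans (Real.rpow_nonneg (Finset.sum_nonneg fun x _ =>
    mul_nonneg (hπ x).le (Real.rpow_nonneg (abs_nonneg _) _)) _) hβ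
  have hlog : 0 ≤ Real.log (1 / ε) := Real.log_nonneg (by rw [le_div_iff₀ hε]; linarith)
  have hεq : 0 ≤ ε ^ (1 / q) := Real.rpow_nonneg hε.le _
  rw [le_div_iff₀ hδ]
  calc (∑ x, |ν x - ρ x|) * δ = δ * ∑ x, |ν x - ρ x| := mul_comm _ _
    _ ≤ ∑ x, ν x * d x := hdist
    _ ≤ (∑ x, π x * d x) ^ (1 - p⁻¹) * (∑ x, π x * d x * (ν x / π x) ^ p) ^ p⁻¹ :=
        hweight ▸ holder
    _ ≤ ε ^ (1 / q) * (2 * β) := by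
        rw [hq]
        refine mul_le_mul (Real.rpow_le_rpow (Finset.sum_nonneg fun x _ =>
          mul_nonneg (hπ x).le (hd0 x)) hdε hq0) hmoment ?_ hεq
        exact Real.rpow_nonneg (Finset.sum_nonneg fun x _ =>
          mul_nonneg (mul_nonneg (hπ x).le (hd0 x)) (Real.rpow_nonneg (hf x) _)) _
    _ ≤ 2 * ε ^ (1 / q) * (1 + Real.log (1 / ε)) * β := by
        nlinarith [mul_nonneg (mul_nonneg hεq hβ0) hlog]
end

section
/- There exists an absolute constant C > 0 with the following property. Let X be a nonempty finite set, let P be a Markov transition matrix on X with stationary distribution π satisfying π(x) > 0 for all x and spectral gap at least γ for some γ ∈ (0,1], and let P̃ be an ε-corruption of P for some ε ∈ (0,1). Let p > 1 with dual exponent q (1/p + 1/q = 1), and suppose the distribution μ is (β,p)-smooth with respect to π for some β ≥ 1. Then there exists δ ∈ (0,1] such that the unique stationary distribution π̃_δ of the PageRank chain P̃(δ)(x,y) := (1−δ)P̃(x,y) + δμ(y) satisfies ‖π̃_δ − π‖₁ ≤ C · sqrt( (β ε^{1/q} / γ) · (1 + log( β ‖μ/π‖_∞ / (ε γ) )) ),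 where ‖ν‖₁ := Σ_x |ν(x)| and ‖μ/π‖_∞ := max_x μ(x)/π(x). -/
open Finset

/-- The action `ν ↦ νP` of a kernel on (signed) weight functions. -/
def push {X : Type*} [Fintype X] (P : X → X → ℝ) (ν : X → ℝ) (y : X) : ℝ :=
  ∑ x, ν x * P x y

/-- The `L²(π)` norm of the density `ν / π`. -/
noncomputable def chiNorm {X : Type*} [Fintype X] (π ν : X → ℝ) : ℝ :=
  √(∑ x, ν x ^ 2 / π x)

/-- The PageRank power iteration `ρ ↦ (1 - δ) ρP + δμ` started at `π`. -/
def pageRankIter {X : Type*} [Fintype X] (P : X → X → ℝ) (π μ : X → ℝ) (δ : ℝ) : ℕ → X → ℝ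
  | 0 => π
  | n + 1 => fun y => (1 - δ) * push P (pageRankIter P π μ δ n) y + δ * μ y

section Push

variable {X : Type*} [Fintype X] {P : X → X → ℝ} {π : X → ℝ}

lemma push_nonneg (hP : ∀ x y, 0 ≤ P x y) {ν : X → ℝ} (hν : ∀ x, 0 ≤ ν x) (y : X) :
    0 ≤ push P ν y :=
  Finset.sum_nonneg fun x _ => mul_nonneg (hν x) (hP x y)

lemma sum_push (hP1 : ∀ x, ∑ y, P x y = 1) (ν : X → ℝ) : ∑ y, push P ν y = ∑ x, ν x := by
  simp only [push]
  rw [Finset.sum_comm]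
  simp [← Finset.mul_sum, hP1]

lemma sum_push_mul (ν f : X → ℝ) :
    ∑ y, push P ν y * f y = ∑ x, ν x * ∑ y, P x y * f y := by
  simp only [push, Finset.sum_mul, Finset.mul_sum]
  rw [Finset.sum_comm]
  simp only [mul_assoc]

lemma push_add (ν ν' : X → ℝ) : push P (ν + ν') = push P ν + push P ν' := by
  ext y
  simp [push, add_mul, Finset.sum_add_distrib]

lemma push_smul (c : ℝ) (ν : X → ℝ) : push P (c • ν) = c • push P ν := by
  ext y
  simp [push, Finset.mul_sum, mul_assoc]

lemma push_sub (ν ν' : X → ℝ) : push P (ν - ν') = push P ν - push P ν' := by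
  ext y
  simp [push, sub_mul, Finset.sum_sub_distrib]

lemma sum_abs_push_le (hP : ∀ x y, 0 ≤ P x y) (hP1 : ∀ x, ∑ y, P x y = 1) (ν : X → ℝ) :
    ∑ y, |push P ν y| ≤ ∑ x, |ν x| := by
  rw [← sum_push hP1 fun x => |ν x|]
  refine Finset.sum_le_sum fun y _ => (Finset.abs_sum_le_sum_abs _ _).trans_eq ?_
  simp [push, abs_mul, abs_of_nonneg (hP _ _)]

lemma iterate_push_add_smul (T : ℕ) (a b : ℝ) (ν ν' : X → ℝ) :
    (push P)^[T] (a • ν + b • ν') = a • (push P)^[T] ν + b • (push P)^[T] ν' := by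
  induction T generalizing ν ν' with
  | zero => rfl
  | succ T ih => simp only [Function.iterate_succ_apply, push_add, push_smul, ih]

lemma sum_iterate_push (hP1 : ∀ x, ∑ y, P x y = 1) (T : ℕ) (ν : X → ℝ) :
    ∑ y, (push P)^[T] ν y = ∑ x, ν x := by
  induction T generalizing ν with
  | zero => rfl
  | succ T ih => rw [Function.iterate_succ_apply, ih, sum_push hP1]

lemma sum_abs_iterate_push_le (hP : ∀ x y, 0 ≤ P x y) (hP1 : ∀ x, ∑ y, P x y = 1) (T : ℕ)
    (ν : X → ℝ) : ∑ y, |(push P)^[T] ν y| ≤ ∑ x, |ν x| := by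
  induction T generalizing ν with
  | zero => rfl
  | succ T ih =>
    rw [Function.iterate_succ_apply]
    exact (ih _).trans (sum_abs_push_le hP hP1 ν)

lemma sum_abs_sub_le_two_s13 {ν ν' : X → ℝ} (hν : ∀ x, 0 ≤ ν x) (hν1 : ∑ x, ν x = 1)
    (hν' : ∀ x, 0 ≤ ν' x) (hν'1 : ∑ x, ν' x = 1) : ∑ x, |ν x - ν' x| ≤ 2 := by
  calc ∑ x, |ν x - ν' x| ≤ ∑ x, (ν x + ν' x) := Finset.sum_le_sum fun x _ => by
        rw [abs_le]; constructor <;> linarith [hν x, hν' x]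
    _ = 2 := by rw [Finset.sum_add_distrib, hν1, hν'1]; norm_num

end Push

section ChiNorm

variable {X : Type*} [Fintype X] {P : X → X → ℝ} {π : X → ℝ}

lemma chiNorm_nonneg (π ν : X → ℝ) : 0 ≤ chiNorm π ν := Real.sqrt_nonneg _

lemma chiNorm_eq_norm (hπ : ∀ x, 0 < π x) (ν : X → ℝ) :
    chiNorm π ν = ‖WithLp.toLp 2 fun x => ν x / √(π x)‖ := by
  rw [EuclideanSpace.norm_eq, chiNorm]
  congr 1
  refine Finset.sum_congr rfl fun x _ => ?_
  simp [div_pow, Real.sq_sqrt (hπ x).le]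

lemma chiNorm_add_le (hπ : ∀ x, 0 < π x) (ν ν' : X → ℝ) :
    chiNorm π (ν + ν') ≤ chiNorm π ν + chiNorm π ν' := by
  simp only [chiNorm_eq_norm hπ]
  refine le_of_eq_of_le ?_ (norm_add_le _ _)
  rw [← WithLp.toLp_add]
  congr 2
  ext x
  simp [add_div]

lemma chiNorm_smul (c : ℝ) (ν : X → ℝ) : chiNorm π (c • ν) = |c| * chiNorm π ν := by
  simp only [chiNorm, Pi.smul_apply, smul_eq_mul, mul_pow, mul_div_assoc, ← Finset.mul_sum]
  rw [Real.sqrt_mul (sq_nonneg c), Real.sqrt_sq_eq_abs]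

lemma sum_mul_le_chiNorm_mul (hπ : ∀ x, 0 < π x) (ν f : X → ℝ) :
    ∑ x, ν x * f x ≤ chiNorm π ν * √(∑ x, π x * f x ^ 2) := by
  have h := Real.sum_mul_le_sqrt_mul_sqrt Finset.univ
    (fun x => ν x / √(π x)) (fun x => √(π x) * f x)
  have hs : ∀ x, √(π x) ≠ 0 := fun x => (Real.sqrt_pos.2 (hπ x)).ne'
  have h1 : ∀ x, ν x / √(π x) * (√(π x) * f x) = ν x * f x := fun x => by
    rw [← mul_assoc, div_mul_cancel₀ _ (hs x)]
  simpa only [chiNorm, h1, div_pow, mul_pow, Real.sq_sqrt (hπ _).le] using h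

lemma sum_abs_le_chiNorm (hπ : ∀ x, 0 < π x) (hπ1 : ∑ x, π x = 1) (ν : X → ℝ) :
    ∑ x, |ν x| ≤ chiNorm π ν := by
  have h := sum_mul_le_chiNorm_mul hπ (fun x => |ν x|) fun _ => 1
  simpa [chiNorm, hπ1] using h

lemma sum_mul_sq_le (hP : ∀ x y, 0 ≤ P x y) (hP1 : ∀ x, ∑ y, P x y = 1)
    (hπ : ∀ x, 0 < π x) (hst : ∀ y, ∑ x, π x * P x y = π y) (f : X → ℝ) :
    ∑ x, π x * (∑ y, P x y * f y) ^ 2 ≤ ∑ x, π x * f x ^ 2 := by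
  calc ∑ x, π x * (∑ y, P x y * f y) ^ 2 ≤ ∑ x, π x * ∑ y, P x y * f y ^ 2 := by
        refine Finset.sum_le_sum fun x _ => mul_le_mul_of_nonneg_left ?_ (hπ x).le
        exact Real.pow_arith_mean_le_arith_mean_pow_of_even _ _ _ (fun y _ => hP x y) (hP1 x)
          even_two
    _ = ∑ y, push P π y * f y ^ 2 := (sum_push_mul π fun y => f y ^ 2).symm
    _ = _ := by simp [push, hst]

/-- The operator bound on mean-zero functions given by the spectral gap. -/
lemma sqrt_sum_mul_sq_le_of_specGap (hP : ∀ x y, 0 ≤ P x y) (hP1 : ∀ x, ∑ y, P x y = 1)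
    (hπ : ∀ x, 0 < π x) (hst : ∀ y, ∑ x, π x * P x y = π y)
    {γ : ℝ} (hγ : γ ≤ specGap P π) {f : X → ℝ} (hf : ∑ x, π x * f x = 0) :
    √(∑ x, π x * (∑ y, P x y * f y) ^ 2) ≤ (1 - γ) * √(∑ x, π x * f x ^ 2) := by
  by_cases hf0 : f = 0
  · simp [hf0]
  have hpos : 0 < √(∑ x, π x * f x ^ 2) := by
    obtain ⟨x, hx⟩ := Function.ne_iff.1 hf0
    exact Real.sqrt_pos.2 <| Finset.sum_pos' (fun x _ => mul_nonneg (hπ x).le (sq_nonneg _))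
      ⟨x, Finset.mem_univ x, mul_pos (hπ x) (sq_pos_of_ne_zero hx)⟩
  rw [← div_le_iff₀ hpos]
  simp only [specGap, sq_abs] at hγ
  refine (le_csSup (s := { r : ℝ | ∃ f : X → ℝ, f ≠ 0 ∧ ∑ x, π x * f x = 0 ∧
      r = √(∑ x, π x * (∑ y, P x y * f y) ^ 2) / √(∑ x, π x * f x ^ 2) })
    ⟨1, ?_⟩ ⟨f, hf0, hf, rfl⟩).trans (by linarith)
  rintro r ⟨g, -, -, rfl⟩
  exact div_le_one_of_le₀ (Real.sqrt_le_sqrt (sum_mul_sq_le hP hP1 hπ hst g)) (Real.sqrt_nonneg _)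

lemma chiNorm_push_le (hP : ∀ x y, 0 ≤ P x y) (hP1 : ∀ x, ∑ y, P x y = 1)
    (hπ : ∀ x, 0 < π x) (hst : ∀ y, ∑ x, π x * P x y = π y)
    {γ : ℝ} (hγ1 : γ ≤ 1) (hγ : γ ≤ specGap P π) {ν : X → ℝ} (hν : ∑ x, ν x = 0) :
    chiNorm π (push P ν) ≤ (1 - γ) * chiNorm π ν := by
  have hπ0 : ∀ x, π x ≠ 0 := fun x => (hπ x).ne'
  set f : X → ℝ := fun y => push P ν y / π y with hf
  have hf0 : ∑ x, π x * f x = 0 := by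
    simp only [hf, mul_div_cancel₀ _ (hπ0 _)]
    rw [sum_push hP1, hν]
  have hK : ∑ x, π x * f x ^ 2 = ∑ y, push P ν y ^ 2 / π y :=
    Finset.sum_congr rfl fun x _ => by simp only [hf]; field_simp [hπ0 x]
  have hfN : √(∑ x, π x * f x ^ 2) = chiNorm π (push P ν) := by rw [hK, chiNorm]
  have hsq : chiNorm π (push P ν) ^ 2 = ∑ y, push P ν y * f y := by
    rw [chiNorm, Real.sq_sqrt (Finset.sum_nonneg fun x _ => div_nonneg (sq_nonneg _) (hπ x).le)]
    exact Finset.sum_congr rfl fun x _ => by simp only [hf]; ring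
  have hcs := sum_mul_le_chiNorm_mul hπ ν fun x => ∑ y, P x y * f y
  rw [← sum_push_mul, ← hsq] at hcs
  have hgap := sqrt_sum_mul_sq_le_of_specGap hP hP1 hπ hst hγ hf0
  rw [hfN] at hgap
  have h := hcs.trans (mul_le_mul_of_nonneg_left hgap (chiNorm_nonneg π ν))
  rcases (chiNorm_nonneg π (push P ν)).eq_or_lt with h0 | h0
  · rw [← h0]
    exact mul_nonneg (by linarith) (chiNorm_nonneg _ _)
  · refine le_of_mul_le_mul_right ?_ h0
    linarith

lemma chiNorm_iterate_push_le (hP : ∀ x y, 0 ≤ P x y) (hP1 : ∀ x, ∑ y, P x y = 1)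
    (hπ : ∀ x, 0 < π x) (hst : ∀ y, ∑ x, π x * P x y = π y)
    {γ : ℝ} (hγ1 : γ ≤ 1) (hγ : γ ≤ specGap P π) (T : ℕ) {ν : X → ℝ} (hν : ∑ x, ν x = 0) :
    chiNorm π ((push P)^[T] ν) ≤ (1 - γ) ^ T * chiNorm π ν := by
  induction T with
  | zero => simp
  | succ T ih =>
    rw [Function.iterate_succ_apply', pow_succ', mul_assoc]
    exact (chiNorm_push_le hP hP1 hπ hst hγ1 hγ ((sum_iterate_push hP1 T ν).trans hν)).trans
      (mul_le_mul_of_nonneg_left ih (by linarith))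

lemma chiNorm_sub_le (hπ : ∀ x, 0 < π x) (hπ1 : ∑ x, π x = 1) {μ : X → ℝ}
    (hμ : ∀ x, 0 ≤ μ x) (hμ1 : ∑ x, μ x = 1) {M : ℝ} (hM1 : 1 ≤ M) (hM : ∀ x, μ x ≤ M * π x) :
    chiNorm π (μ - π) ≤ M := by
  refine Real.sqrt_le_iff.2 ⟨by linarith, ?_⟩
  calc ∑ x, (μ - π) x ^ 2 / π x ≤ ∑ x, (M * μ x - 2 * μ x + π x) := by
        refine Finset.sum_le_sum fun x _ => ?_
        rw [div_le_iff₀ (hπ x), Pi.sub_apply]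
        nlinarith [mul_le_mul_of_nonneg_left (hM x) (hμ x)]
    _ = M - 1 := by
        rw [Finset.sum_add_distrib, Finset.sum_sub_distrib, ← Finset.mul_sum, ← Finset.mul_sum,
          hμ1, hπ1]
        ring
    _ ≤ M ^ 2 := by nlinarith

end ChiNorm

section Smooth

variable {X : Type*} [Fintype X] {P : X → X → ℝ} {π : X → ℝ}

/-- Jensen's inequality: pushing forward contracts the `p`-th moment of the density. -/
lemma sum_mul_push_div_rpow_le (hP : ∀ x y, 0 ≤ P x y) (hP1 : ∀ x, ∑ y, P x y = 1)
    (hπ : ∀ x, 0 < π x) (hst : ∀ y, ∑ x, π x * P x y = π y) {p : ℝ} (hp : 1 ≤ p)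
    {ρ : X → ℝ} (hρ : ∀ x, 0 ≤ ρ x) :
    ∑ y, π y * (push P ρ y / π y) ^ p ≤ ∑ x, π x * (ρ x / π x) ^ p := by
  have hπ0 : ∀ x, π x ≠ 0 := fun x => (hπ x).ne'
  calc ∑ y, π y * (push P ρ y / π y) ^ p
      ≤ ∑ y, π y * ∑ x, (π x * P x y / π y) * (ρ x / π x) ^ p := by
        refine Finset.sum_le_sum fun y _ => mul_le_mul_of_nonneg_left ?_ (hπ y).le
        have h := Real.rpow_arith_mean_le_arith_mean_rpow Finset.univ
          (fun x => π x * P x y / π y) (fun x => ρ x / π x)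
          (fun x _ => div_nonneg (mul_nonneg (hπ x).le (hP x y)) (hπ y).le)
          (by rw [← Finset.sum_div, hst, div_self (hπ0 y)])
          (fun x _ => div_nonneg (hρ x) (hπ x).le) hp
        refine le_of_eq_of_le ?_ h
        congr 1
        rw [push, Finset.sum_div]
        refine Finset.sum_congr rfl fun x _ => ?_
        field_simp [hπ0 x, hπ0 y]
    _ = ∑ y, ∑ x, π x * (ρ x / π x) ^ p * P x y := by
        refine Finset.sum_congr rfl fun y _ => ?_
        rw [Finset.mul_sum]
        refine Finset.sum_congr rfl fun x _ => ?_
        field_simp [hπ0 y]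
    _ = _ := sum_push hP1 fun x => π x * (ρ x / π x) ^ p

lemma sum_mul_convex_combination_div_rpow_le (hπ : ∀ x, 0 < π x) {p : ℝ} (hp : 1 ≤ p)
    {δ : ℝ} (hδ0 : 0 ≤ δ) (hδ1 : δ ≤ 1) {a b : X → ℝ} (ha : ∀ x, 0 ≤ a x) (hb : ∀ x, 0 ≤ b x)
    {B : ℝ} (haB : ∑ x, π x * (a x / π x) ^ p ≤ B) (hbB : ∑ x, π x * (b x / π x) ^ p ≤ B) :
    ∑ x, π x * (((1 - δ) * a x + δ * b x) / π x) ^ p ≤ B := by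
  calc ∑ x, π x * (((1 - δ) * a x + δ * b x) / π x) ^ p
      ≤ ∑ x, ((1 - δ) * (π x * (a x / π x) ^ p) + δ * (π x * (b x / π x) ^ p)) := by
        refine Finset.sum_le_sum fun x _ => ?_
        have h := (convexOn_rpow hp).2 (div_nonneg (ha x) (hπ x).le)
          (div_nonneg (hb x) (hπ x).le) (sub_nonneg.2 hδ1) hδ0 (by ring)
        simp only [smul_eq_mul] at h
        rw [add_div, mul_div_assoc, mul_div_assoc]
        calc _ ≤ _ := mul_le_mul_of_nonneg_left h (hπ x).le
          _ = _ := by ring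
    _ = (1 - δ) * ∑ x, π x * (a x / π x) ^ p + δ * ∑ x, π x * (b x / π x) ^ p := by
        rw [Finset.sum_add_distrib, Finset.mul_sum, Finset.mul_sum]
    _ ≤ (1 - δ) * B + δ * B := by gcongr
    _ = B := by ring

/-- Hölder's inequality for the density of `ρ` against a function with values in `[0, 1]`. -/
lemma sum_mul_le_of_smooth (hπ : ∀ x, 0 < π x) {p q : ℝ} (hpq : p.HolderConjugate q)
    {ρ e : X → ℝ} (hρ : ∀ x, 0 ≤ ρ x) (he : ∀ x, 0 ≤ e x) (he1 : ∀ x, e x ≤ 1)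
    {β ε : ℝ} (hβ : 0 ≤ β) (hρβ : ∑ x, π x * (ρ x / π x) ^ p ≤ β ^ p)
    (hε : ∑ x, π x * e x ≤ ε) :
    ∑ x, ρ x * e x ≤ β * ε ^ (1 / q) := by
  have hp0 := hpq.ne_zero
  have hq0 := hpq.symm.ne_zero
  have hpow : ∀ {r : ℝ}, r ≠ 0 → ∀ {a b : ℝ}, 0 ≤ a → 0 ≤ b →
      (a ^ (1 / r) * b) ^ r = a * b ^ r := by
    intro r hr a b ha hb
    rw [Real.mul_rpow (Real.rpow_nonneg ha _) hb, ← Real.rpow_mul ha, one_div_mul_cancel hr,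
      Real.rpow_one]
  have h := Real.inner_le_Lp_mul_Lq_of_nonneg Finset.univ hpq
    (f := fun x => π x ^ (1 / p) * (ρ x / π x)) (g := fun x => π x ^ (1 / q) * e x)
    (fun x _ => mul_nonneg (Real.rpow_nonneg (hπ x).le _) (div_nonneg (hρ x) (hπ x).le))
    (fun x _ => mul_nonneg (Real.rpow_nonneg (hπ x).le _) (he x))
  simp only [hpow hp0 (hπ _).le (div_nonneg (hρ _) (hπ _).le), hpow hq0 (hπ _).le (he _)] at h
  have hlhs : ∑ x, ρ x * e x
      = ∑ x, π x ^ (1 / p) * (ρ x / π x) * (π x ^ (1 / q) * e x) := by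
    refine Finset.sum_congr rfl fun x _ => ?_
    have h1 : π x ^ (1 / p) * π x ^ (1 / q) = π x := by
      rw [← Real.rpow_add (hπ x), one_div, one_div, hpq.inv_add_inv_eq_one, Real.rpow_one]
    calc ρ x * e x = π x * (ρ x / π x) * e x := by rw [mul_div_cancel₀ _ (hπ x).ne']
      _ = π x ^ (1 / p) * π x ^ (1 / q) * (ρ x / π x) * e x := by rw [h1]
      _ = _ := by ring
  rw [hlhs]
  refine h.trans (mul_le_mul ?_ ?_ (Real.rpow_nonneg (Finset.sum_nonneg fun x _ =>
    mul_nonneg (hπ x).le (Real.rpow_nonneg (he x) _)) _) hβ)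
  · calc _ ≤ (β ^ p) ^ (1 / p) := Real.rpow_le_rpow (Finset.sum_nonneg fun x _ =>
          mul_nonneg (hπ x).le (Real.rpow_nonneg (div_nonneg (hρ x) (hπ x).le) _)) hρβ
          (one_div_nonneg.2 hpq.nonneg)
      _ = β := by rw [← Real.rpow_mul hβ, mul_one_div_cancel hp0, Real.rpow_one]
  · refine Real.rpow_le_rpow (Finset.sum_nonneg fun x _ =>
      mul_nonneg (hπ x).le (Real.rpow_nonneg (he x) _)) (le_trans ?_ hε)
      (one_div_nonneg.2 hpq.symm.nonneg)
    refine Finset.sum_le_sum fun x _ => mul_le_mul_of_nonneg_left ?_ (hπ x).le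
    simpa using Real.rpow_le_rpow_of_exponent_ge_of_imp (he x) (he1 x) hpq.symm.lt.le
      fun _ h => absurd h hq0

end Smooth

section PageRank

variable {X : Type*} [Fintype X] {P : X → X → ℝ} {π μ : X → ℝ} {δ : ℝ}

lemma pageRankIter_nonneg (hP : ∀ x y, 0 ≤ P x y) (hπ : ∀ x, 0 < π x) (hμ : ∀ x, 0 ≤ μ x)
    (hδ0 : 0 ≤ δ) (hδ1 : δ ≤ 1) (n : ℕ) (x : X) : 0 ≤ pageRankIter P π μ δ n x := by
  induction n generalizing x with
  | zero => exact (hπ x).le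
  | succ n ih =>
    exact add_nonneg (mul_nonneg (sub_nonneg.2 hδ1) (push_nonneg hP ih x)) (mul_nonneg hδ0 (hμ x))

lemma sum_pageRankIter (hP1 : ∀ x, ∑ y, P x y = 1) (hπ1 : ∑ x, π x = 1) (hμ1 : ∑ x, μ x = 1)
    (n : ℕ) : ∑ x, pageRankIter P π μ δ n x = 1 := by
  induction n with
  | zero => exact hπ1
  | succ n ih =>
    simp only [pageRankIter]
    rw [Finset.sum_add_distrib, ← Finset.mul_sum, ← Finset.mul_sum, sum_push hP1, ih, hμ1]
    ring

lemma pageRankIter_smooth (hP : ∀ x y, 0 ≤ P x y) (hP1 : ∀ x, ∑ y, P x y = 1)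
    (hπ : ∀ x, 0 < π x) (hπ1 : ∑ x, π x = 1) (hst : ∀ y, ∑ x, π x * P x y = π y)
    (hμ : ∀ x, 0 ≤ μ x) (hδ0 : 0 ≤ δ) (hδ1 : δ ≤ 1) {p : ℝ} (hp : 1 ≤ p) {B : ℝ} (hB : 1 ≤ B)
    (hμB : ∑ x, π x * (μ x / π x) ^ p ≤ B) (n : ℕ) :
    ∑ x, π x * (pageRankIter P π μ δ n x / π x) ^ p ≤ B := by
  induction n with
  | zero => simpa [pageRankIter, div_self (hπ _).ne', hπ1] using hB
  | succ n ih =>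
    have hρ := pageRankIter_nonneg hP hπ hμ hδ0 hδ1 n
    exact sum_mul_convex_combination_div_rpow_le hπ hp hδ0 hδ1 (push_nonneg hP hρ) hμ
      ((sum_mul_push_div_rpow_le hP hP1 hπ hst hp hρ).trans ih) hμB

lemma pageRankIter_succ_sub (hst : ∀ y, ∑ x, π x * P x y = π y) (n : ℕ) :
    pageRankIter P π μ δ (n + 1) - π
      = (1 - δ) • push P (pageRankIter P π μ δ n - π) + δ • (μ - π) := by
  have hstat : push P π = π := funext hst
  rw [push_sub, hstat]
  ext y
  simp [pageRankIter]
  ring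

lemma chiNorm_pageRankIter_sub_le (hP : ∀ x y, 0 ≤ P x y) (hP1 : ∀ x, ∑ y, P x y = 1)
    (hπ : ∀ x, 0 < π x) (hπ1 : ∑ x, π x = 1) (hst : ∀ y, ∑ x, π x * P x y = π y)
    {γ : ℝ} (hγ0 : 0 < γ) (hγ1 : γ ≤ 1) (hγ : γ ≤ specGap P π)
    (hμ1 : ∑ x, μ x = 1) (hδ0 : 0 ≤ δ) (hδ1 : δ ≤ 1) (n : ℕ) :
    chiNorm π (pageRankIter P π μ δ n - π) ≤ δ * chiNorm π (μ - π) / γ := by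
  have hG := chiNorm_nonneg π (μ - π)
  induction n with
  | zero =>
    rw [show chiNorm π (pageRankIter P π μ δ 0 - π) = 0 by simp [pageRankIter, chiNorm]]
    positivity
  | succ n ih =>
    have h0 : ∑ x, (pageRankIter P π μ δ n - π) x = 0 := by
      simp [Finset.sum_sub_distrib, sum_pageRankIter hP1 hπ1 hμ1, hπ1]
    have h1 := chiNorm_push_le hP hP1 hπ hst hγ1 hγ h0
    rw [pageRankIter_succ_sub hst]
    calc _ ≤ _ := chiNorm_add_le hπ _ _
      _ = (1 - δ) * chiNorm π (push P (pageRankIter P π μ δ n - π))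
          + δ * chiNorm π (μ - π) := by
        rw [chiNorm_smul, chiNorm_smul, abs_of_nonneg hδ0, abs_of_nonneg (sub_nonneg.2 hδ1)]
      _ ≤ 1 * ((1 - γ) * (δ * chiNorm π (μ - π) / γ)) + δ * chiNorm π (μ - π) := by
        gcongr
        · exact chiNorm_nonneg _ _
        · linarith
        · exact h1.trans (mul_le_mul_of_nonneg_left ih (sub_nonneg.2 hγ1))
      _ = _ := by field_simp; ring

/-- Unrolling `T` steps of the iteration costs at most `2δT` in total mass. -/
lemma sum_abs_iterate_push_pageRankIter_sub_le (hP : ∀ x y, 0 ≤ P x y)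
    (hP1 : ∀ x, ∑ y, P x y = 1) (hπ : ∀ x, 0 < π x) (hπ1 : ∑ x, π x = 1)
    (hst : ∀ y, ∑ x, π x * P x y = π y)
    {γ : ℝ} (hγ0 : 0 < γ) (hγ1 : γ ≤ 1) (hγ : γ ≤ specGap P π)
    (hμ : ∀ x, 0 ≤ μ x) (hμ1 : ∑ x, μ x = 1) (hδ0 : 0 ≤ δ) (hδ1 : δ ≤ 1) (T S n : ℕ) :
    ∑ x, |(push P)^[S] (pageRankIter P π μ δ n - π) x|
      ≤ 2 * δ * T + (1 - γ) ^ (S + T) * (δ * chiNorm π (μ - π) / γ) := by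
  have hG := chiNorm_nonneg π (μ - π)
  have hγ' := sub_nonneg.2 hγ1
  induction T generalizing S n with
  | zero =>
    have h0 : ∑ x, (pageRankIter P π μ δ n - π) x = 0 := by
      simp [Finset.sum_sub_distrib, sum_pageRankIter hP1 hπ1 hμ1, hπ1]
    calc _ ≤ _ := sum_abs_le_chiNorm hπ hπ1 _
      _ ≤ _ := chiNorm_iterate_push_le hP hP1 hπ hst hγ1 hγ S h0
      _ ≤ (1 - γ) ^ S * (δ * chiNorm π (μ - π) / γ) := mul_le_mul_of_nonneg_left
          (chiNorm_pageRankIter_sub_le hP hP1 hπ hπ1 hst hγ0 hγ1 hγ hμ1 hδ0 hδ1 n) (by positivity)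
      _ = _ := by simp
  | succ T ih =>
    cases n with
    | zero =>
      have h0 : (push P)^[S] (pageRankIter P π μ δ 0 - π) = 0 := by
        have h := iterate_push_add_smul (P := P) S 0 0 0 0
        simpa [pageRankIter] using h
      rw [h0]
      simp only [Pi.zero_apply, abs_zero, Finset.sum_const_zero]
      positivity
    | succ n =>
      rw [pageRankIter_succ_sub hst, iterate_push_add_smul, ← Function.iterate_succ_apply]
      have h1 := ih (S + 1) n
      have h2 : ∑ x, |(push P)^[S] (μ - π) x| ≤ 2 :=
        (sum_abs_iterate_push_le hP hP1 S _).trans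
          (sum_abs_sub_le_two_s13 hμ hμ1 (fun x => (hπ x).le) hπ1)
      calc ∑ x, |((1 - δ) • (push P)^[S + 1] (pageRankIter P π μ δ n - π)
              + δ • (push P)^[S] (μ - π)) x|
          ≤ ∑ x, (|(push P)^[S + 1] (pageRankIter P π μ δ n - π) x|
              + δ * |(push P)^[S] (μ - π) x|) := by
            refine Finset.sum_le_sum fun x _ => (abs_add_le _ _).trans ?_
            simp only [Pi.smul_apply, smul_eq_mul, abs_mul, abs_of_nonneg hδ0,
              abs_of_nonneg (sub_nonneg.2 hδ1)]
            gcongr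
            exact mul_le_of_le_one_left (abs_nonneg _) (by linarith)
        _ ≤ (2 * δ * T + (1 - γ) ^ (S + 1 + T) * (δ * chiNorm π (μ - π) / γ)) + δ * 2 := by
            rw [Finset.sum_add_distrib, ← Finset.mul_sum]
            gcongr
        _ = _ := by
            rw [show S + 1 + T = S + (T + 1) by ring]
            push_cast
            ring

lemma sum_abs_pageRankIter_sub_le (hP : ∀ x y, 0 ≤ P x y)
    (hP1 : ∀ x, ∑ y, P x y = 1) (hπ : ∀ x, 0 < π x) (hπ1 : ∑ x, π x = 1)
    (hst : ∀ y, ∑ x, π x * P x y = π y)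
    {γ : ℝ} (hγ0 : 0 < γ) (hγ1 : γ ≤ 1) (hγ : γ ≤ specGap P π)
    (hμ : ∀ x, 0 ≤ μ x) (hμ1 : ∑ x, μ x = 1) (hδ0 : 0 ≤ δ) (hδ1 : δ ≤ 1)
    {M : ℝ} (hM1 : 1 ≤ M) (hM : ∀ x, μ x ≤ M * π x) (n : ℕ) :
    ∑ x, |pageRankIter P π μ δ n x - π x| ≤ 3 * (δ * (1 + Real.log M) / γ) := by
  have hlog := Real.log_nonneg hM1
  have hM0 : 0 < M := by linarith
  set T := ⌈Real.log M / γ⌉₊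
  have hT1 : Real.log M / γ ≤ T := Nat.le_ceil _
  have hT2 : (T : ℝ) ≤ Real.log M / γ + 1 := (Nat.ceil_lt_add_one (by positivity)).le
  have h := sum_abs_iterate_push_pageRankIter_sub_le hP hP1 hπ hπ1 hst hγ0 hγ1 hγ hμ hμ1
    hδ0 hδ1 T 0 n
  have hpow : (1 - γ) ^ T ≤ 1 / M := by
    calc (1 - γ) ^ T ≤ Real.exp (-γ) ^ T :=
          pow_le_pow_left₀ (sub_nonneg.2 hγ1) (Real.one_sub_le_exp_neg γ) T
      _ = Real.exp (-(γ * T)) := by rw [← Real.exp_nat_mul]; ring_nf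
      _ ≤ Real.exp (-Real.log M) := by
          rw [div_le_iff₀ hγ0] at hT1
          exact Real.exp_le_exp.2 (by linarith)
      _ = 1 / M := by rw [Real.exp_neg, Real.exp_log hM0, one_div]
  have h2 : (1 - γ) ^ (0 + T) * (δ * chiNorm π (μ - π) / γ) ≤ δ / γ := by
    rw [zero_add]
    calc _ ≤ 1 / M * (δ * M / γ) := by
          gcongr
          · exact div_nonneg (mul_nonneg hδ0 (chiNorm_nonneg _ _)) hγ0.le
          · exact chiNorm_sub_le hπ hπ1 hμ hμ1 hM1 hM
      _ = δ / γ := by field_simp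
  have h3 : 2 * δ * T ≤ 2 * δ * (Real.log M / γ + 1 / γ) := by
    have : 1 ≤ 1 / γ := by rw [le_div_iff₀ hγ0]; linarith
    gcongr
    linarith
  have h4 : 0 ≤ δ * Real.log M / γ := by positivity
  calc _ ≤ _ := h
    _ ≤ 2 * δ * (Real.log M / γ + 1 / γ) + δ / γ := add_le_add h3 h2
    _ = 3 * (δ * (1 + Real.log M) / γ) - δ * Real.log M / γ := by ring
    _ ≤ _ := by linarith

/-- Distance from a stationary distribution of the corrupted PageRank chain to the iteration,
when every iterate sees a corruption of mass at most `D`. -/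
lemma sum_abs_sub_pageRankIter_le {Pt : X → X → ℝ} (hP : ∀ x y, 0 ≤ P x y)
    (hPt : ∀ x y, 0 ≤ Pt x y) (hPt1 : ∀ x, ∑ y, Pt x y = 1)
    (hπ : ∀ x, 0 < π x) (hπ1 : ∑ x, π x = 1) (hμ : ∀ x, 0 ≤ μ x)
    (hδ0 : 0 < δ) (hδ1 : δ ≤ 1) {D : ℝ}
    (hD : ∀ n, ∑ x, pageRankIter P π μ δ n x * ∑ y, |P x y - Pt x y| ≤ D)
    {πt : X → ℝ} (hπt : ∀ x, 0 ≤ πt x) (hπt1 : ∑ x, πt x = 1)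
    (hπtst : ∀ y, ∑ x, πt x * ((1 - δ) * Pt x y + δ * μ y) = πt y) (n : ℕ) :
    ∑ x, |πt x - pageRankIter P π μ δ n x| ≤ 2 * (1 - δ) ^ n + D / δ := by
  have hδ' := sub_nonneg.2 hδ1
  have hD0 : 0 ≤ D := le_trans (Finset.sum_nonneg fun x _ => mul_nonneg
    (pageRankIter_nonneg hP hπ hμ hδ0.le hδ1 0 x)
    (Finset.sum_nonneg fun y _ => abs_nonneg _)) (hD 0)
  induction n with
  | zero =>
    have := sum_abs_sub_le_two_s13 hπt hπt1 (fun x => (hπ x).le) hπ1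
    have : 0 ≤ D / δ := by positivity
    simp only [pageRankIter, pow_zero]
    linarith
  | succ n ih =>
    set ρ := pageRankIter P π μ δ n with hρ
    have hρ0 : ∀ x, 0 ≤ ρ x := pageRankIter_nonneg hP hπ hμ hδ0.le hδ1 n
    have hstep : ∀ y, πt y - pageRankIter P π μ δ (n + 1) y
        = (1 - δ) * (push Pt (πt - ρ) y - ∑ x, ρ x * (P x y - Pt x y)) := by
      intro y
      have h1 : πt y = (1 - δ) * push Pt πt y + δ * μ y := by
        rw [← hπtst y, push, Finset.mul_sum]
        nth_rewrite 2 [← mul_one (δ * μ y)]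
        rw [← hπt1, Finset.mul_sum, ← Finset.sum_add_distrib]
        exact Finset.sum_congr rfl fun x _ => by ring
      have h2 : ∑ x, ρ x * (P x y - Pt x y) = push P ρ y - push Pt ρ y := by
        simp [push, mul_sub, Finset.sum_sub_distrib]
      rw [h1, h2, push_sub]
      simp only [pageRankIter, Pi.sub_apply]
      rw [← hρ]
      ring
    have hcorr : ∑ y, |∑ x, ρ x * (P x y - Pt x y)| ≤ D := by
      refine le_trans ?_ (hD n)
      calc _ ≤ ∑ y, ∑ x, ρ x * |P x y - Pt x y| := by
            refine Finset.sum_le_sum fun y _ => (Finset.abs_sum_le_sum_abs _ _).trans_eq ?_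
            simp [abs_mul, abs_of_nonneg (hρ0 _)]
        _ = _ := by rw [Finset.sum_comm]; simp [Finset.mul_sum, hρ]
    calc ∑ y, |πt y - pageRankIter P π μ δ (n + 1) y|
        ≤ ∑ y, (1 - δ) * (|push Pt (πt - ρ) y| + |∑ x, ρ x * (P x y - Pt x y)|) := by
          refine Finset.sum_le_sum fun y _ => ?_
          rw [hstep, abs_mul, abs_of_nonneg hδ']
          exact mul_le_mul_of_nonneg_left (abs_sub _ _) hδ'
      _ ≤ (1 - δ) * ((2 * (1 - δ) ^ n + D / δ) + D) := by
          rw [← Finset.mul_sum, Finset.sum_add_distrib]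
          exact mul_le_mul_of_nonneg_left
            (add_le_add ((sum_abs_push_le hPt hPt1 _).trans ih) hcorr) hδ'
      _ = 2 * (1 - δ) ^ (n + 1) + D / δ - δ * D := by field_simp; ring
      _ ≤ _ := by nlinarith

end PageRank

/-- (Main theorem.) There is an absolute constant `C > 0` such
that for any chain `P` with positive stationary distribution `π` and spectral gap
at least `γ ∈ (0,1]`, any `ε`-corruption `P̃` with `ε ∈ (0,1)`, any `p > 1` with
dual exponent `q`, and any `(β,p)`-smooth restart distribution `μ` with `β ≥ 1`,
there is a choice of `δ ∈ (0,1]` so that the stationary distribution `π̃_δ` of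
the PageRank chain `(1−δ)P̃ + δ𝟙ᵀμ` satisfies
`‖π̃_δ − π‖₁ ≤ C √((β ε^{1/q}/γ)(1 + log(β ‖μ/π‖_∞/(εγ))))`. -/
theorem main_robust_recovery :
    ∃ C : ℝ, 0 < C ∧
      ∀ (X : Type) [Fintype X] [Nonempty X]
        (P Pt : X → X → ℝ) (π : X → ℝ) (ε γ : ℝ),
        (∀ x y, 0 ≤ P x y) → (∀ x, ∑ y, P x y = 1) →
        (∀ x y, 0 ≤ Pt x y) → (∀ x, ∑ y, Pt x y = 1) →
        (∀ x, 0 < π x) → (∑ x, π x = 1) →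
        (∀ y, ∑ x, π x * P x y = π y) →
        0 < γ → γ ≤ 1 → γ ≤ specGap P π →
        0 < ε → ε < 1 →
        (∑ x, ∑ y, π x * |P x y - Pt x y| ≤ ε) →
        ∀ p q β : ℝ, 1 < p → 1 / p + 1 / q = 1 → 1 ≤ β →
        ∀ μ : X → ℝ, (∀ x, 0 ≤ μ x) → (∑ x, μ x = 1) →
        ((∑ x, π x * |μ x / π x| ^ p) ^ (1 / p) ≤ β) →
        ∃ δ : ℝ, 0 < δ ∧ δ ≤ 1 ∧
          ∀ πtδ : X → ℝ, (∀ x, 0 ≤ πtδ x) → (∑ x, πtδ x = 1) →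
          (∀ y, ∑ x, πtδ x * ((1 - δ) * Pt x y + δ * μ y) = πtδ y) →
          ∑ x, |πtδ x - π x| ≤
            C * Real.sqrt ((β * ε ^ (1 / q) / γ) *
              (1 + Real.log (β * (⨆ x, μ x / π x) / (ε * γ)))) := by
  refine ⟨6, by norm_num, ?_⟩
  intro X _ _ P Pt π ε γ hP hP1 hPt hPt1 hπ hπ1 hst hγ0 hγ1 hγ hε0 hε1 hcor p q β hp hpq hβ
    μ hμ hμ1 hsm
  have hπ0 : ∀ x, π x ≠ 0 := fun x => (hπ x).ne'
  have hHolder : p.HolderConjugate q :=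
    Real.holderConjugate_iff.2 ⟨hp, by simpa only [one_div] using hpq⟩
  set M := ⨆ x, μ x / π x with hMdef
  have hM : ∀ x, μ x ≤ M * π x := fun x => by
    rw [← div_le_iff₀ (hπ x)]
    exact le_ciSup (f := fun x => μ x / π x) (Set.finite_range _).bddAbove x
  have hM1 : 1 ≤ M := by
    have h := Finset.sum_le_sum fun x (_ : x ∈ Finset.univ) => hM x
    rwa [hμ1, ← Finset.mul_sum, hπ1, mul_one] at h
  set A := β * ε ^ (1 / q) with hAdef
  set L := Real.log (β * M / (ε * γ)) with hLdef
  have hA0 : 0 < A := mul_pos (by linarith) (Real.rpow_pos_of_pos hε0 _)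
  have hML : Real.log M ≤ L := by
    refine Real.log_le_log (by linarith) ?_
    rw [le_div_iff₀ (mul_pos hε0 hγ0)]
    have : ε * γ ≤ 1 := mul_le_one₀ hε1.le hγ0.le hγ1
    nlinarith
  have hL0 : 0 ≤ L := (Real.log_nonneg hM1).trans hML
  have hS0 : 0 < A / γ * (1 + L) := by positivity
  set S := √(A / γ * (1 + L)) with hSdef
  have hSpos : 0 < S := Real.sqrt_pos.2 hS0
  have hSsq : S ^ 2 = A / γ * (1 + L) := Real.sq_sqrt hS0.le
  rcases le_or_gt 1 S with hS1 | hS1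
  · refine ⟨1, one_pos, le_rfl, fun πt hπt hπt1 _ => ?_⟩
    have := sum_abs_sub_le_two_s13 hπt hπt1 (fun x => (hπ x).le) hπ1
    linarith
  have hδ0 : 0 < A / S := div_pos hA0 hSpos
  have hδ1 : A / S ≤ 1 := by
    rw [div_le_one hSpos]
    have hAγ : A ≤ A / γ := by rw [le_div_iff₀ hγ0]; nlinarith
    have : A / γ ≤ S ^ 2 := by rw [hSsq]; nlinarith [div_pos hA0 hγ0]
    nlinarith
  refine ⟨A / S, hδ0, hδ1, fun πt hπt hπt1 hπtst => ?_⟩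
  set δ := A / S with hδdef
  have hAδ : A / δ = S := by rw [hδdef]; field_simp
  have hδL : δ * (1 + L) / γ = S := by
    have : δ * (1 + L) / γ = S ^ 2 / S := by rw [hSsq, hδdef]; ring
    rw [this, sq, mul_self_div_self]
  have hμβ : ∑ x, π x * (μ x / π x) ^ p ≤ β ^ p := by
    have hnn : ∀ x, 0 ≤ μ x / π x := fun x => div_nonneg (hμ x) (hπ x).le
    simp only [abs_of_nonneg (hnn _), one_div] at hsm
    exact (Real.rpow_inv_le_iff_of_pos (Finset.sum_nonneg fun x _ =>
      mul_nonneg (hπ x).le (Real.rpow_nonneg (hnn x) _)) (by linarith) (by linarith)).1 hsm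
  have hD : ∀ n, ∑ x, pageRankIter P π μ δ n x * ∑ y, |P x y - Pt x y| ≤ 2 * A := by
    intro n
    have h := sum_mul_le_of_smooth hπ hHolder (e := fun x => (∑ y, |P x y - Pt x y|) / 2)
      (pageRankIter_nonneg hP hπ hμ hδ0.le hδ1 n)
      (fun x => div_nonneg (Finset.sum_nonneg fun y _ => abs_nonneg _) zero_le_two)
      (fun x => by
        have := sum_abs_sub_le_two_s13 (hP x) (hP1 x) (hPt x) (hPt1 x)
        linarith)
      (by linarith : (0 : ℝ) ≤ β)
      (pageRankIter_smooth hP hP1 hπ hπ1 hst hμ hδ0.le hδ1 hp.le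
        (Real.one_le_rpow hβ (by linarith)) hμβ n)
      (ε := ε) (by
        simp only [← mul_div_assoc, ← Finset.sum_div, Finset.mul_sum]
        linarith)
    simp only [← mul_div_assoc, ← Finset.sum_div] at h
    linarith
  obtain ⟨n, hn⟩ := exists_pow_lt_of_lt_one (half_pos hSpos) (by linarith : 1 - δ < 1)
  have h1 := sum_abs_sub_pageRankIter_le hP hPt hPt1 hπ hπ1 hμ hδ0 hδ1 hD hπt hπt1 hπtst n
  have h2 := sum_abs_pageRankIter_sub_le hP hP1 hπ hπ1 hst hγ0 hγ1 hγ hμ hμ1 hδ0.le hδ1 hM1 hM n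
  have h3 : δ * (1 + Real.log M) / γ ≤ S := by
    rw [← hδL]
    gcongr
  rw [mul_div_assoc, hAδ] at h1
  calc ∑ x, |πt x - π x|
      ≤ ∑ x, (|πt x - pageRankIter P π μ δ n x| + |pageRankIter P π μ δ n x - π x|) :=
        Finset.sum_le_sum fun x _ => abs_sub_le _ _ _
    _ ≤ 6 * S := by
        rw [Finset.sum_add_distrib]
        linarith
end

section
/- Let n ≥ 1 and δ ∈ (0,1). On the hypercube X = {−1,1}ⁿ, let P and P̃ be the random-scan product chains in which a uniformly random coordinate i is chosen and resampled to 1 with probability p_i (respectively p̃_i), where p₁ = 1/2 + δ/2, p̃₁ = 1/2 − δ/2, and p_i = p̃_i = 1/2 for all i ≥ 2. Let π and π̃ be their respective stationary product distributions, π(x) = Π_i (p_i if x_i = 1 else 1 − p_i) and π̃(x) = Π_i (p̃_i if x_i = 1 else 1 − p̃_i). Then: (a) Σ_{x,y} π(x) |P(x,y) − P̃(x,y)| = 2δ/n, so P̃ is a (2δ/n)-corruption of P; and (b) d_TV(π, π̃) = δ, where d_TV(π, π̃) := (1/2) Σ_x |π(x) − π̃(x)|. -/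
open Finset

/-- A product of Bernoulli weights sums to one over the hypercube. -/
theorem sum_prod_bernoulli {n : ℕ} (p : Fin n → ℝ) :
    ∑ x : Fin n → Bool, ∏ i, (if x i then p i else 1 - p i) = 1 := by
  rw [← Fintype.prod_sum fun i (b : Bool) => if b then p i else 1 - p i]
  simp

/-- Exactly two points of the hypercube agree with `x` away from the coordinate `0`. -/
theorem sum_agree_off_zero {m : ℕ} (x : Fin (m + 1) → Bool) :
    ∑ y : Fin (m + 1) → Bool, (if ∀ j, j ≠ 0 → y j = x j then (1 : ℝ) else 0) = 2 := by
  rw [← (Fin.consEquiv fun _ : Fin (m + 1) => Bool).sum_comp, Fintype.sum_prod_type]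
  have h (t : Fin m → Bool) : (∀ j, t j = x (Fin.succ j)) ↔ t = Fin.tail x :=
    funext_iff.symm
  simp [Fin.consEquiv, Fin.forall_fin_succ, h]

/-- On the hypercube `{−1,1}ⁿ` (encoded as `Fin n → Bool`,
`true` playing the role of `1`), consider the random-scan product chains `P` and
`P̃` with resampling probabilities `p₁ = 1/2 + δ/2`, `p̃₁ = 1/2 − δ/2` in the
first coordinate and `1/2` elsewhere, with stationary product distributions `π`
and `π̃`. Then `Σ_{x,y} π(x)|P(x,y) − P̃(x,y)| = 2δ/n` (so `P̃` is a
`(2δ/n)`-corruption of `P`), and `d_TV(π, π̃) = δ`. -/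
theorem product_chain_corruption_lower_bound (n : ℕ) (hn : 1 ≤ n)
    (δ : ℝ) (hδ0 : 0 < δ) (hδ1 : δ < 1)
    (p pt : Fin n → ℝ)
    (hp : ∀ i, p i = if (i : ℕ) = 0 then 1 / 2 + δ / 2 else 1 / 2)
    (hpt : ∀ i, pt i = if (i : ℕ) = 0 then 1 / 2 - δ / 2 else 1 / 2)
    (P Pt : (Fin n → Bool) → (Fin n → Bool) → ℝ)
    (hP : ∀ x y, P x y = ∑ i, (1 / (n : ℝ)) *
      (if y i then p i else 1 - p i) *
      (if ∀ j, j ≠ i → y j = x j then 1 else 0))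
    (hPt : ∀ x y, Pt x y = ∑ i, (1 / (n : ℝ)) *
      (if y i then pt i else 1 - pt i) *
      (if ∀ j, j ≠ i → y j = x j then 1 else 0))
    (π πt : (Fin n → Bool) → ℝ)
    (hπ : ∀ x, π x = ∏ i, (if x i then p i else 1 - p i))
    (hπt : ∀ x, πt x = ∏ i, (if x i then pt i else 1 - pt i)) :
    (∑ x, ∑ y, π x * |P x y - Pt x y| = 2 * δ / n) ∧
      (1 / 2) * ∑ x, |π x - πt x| = δ := by
  obtain ⟨m, rfl⟩ : ∃ m, n = m + 1 := ⟨n - 1, by omega⟩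
  have hm : ((m + 1 : ℕ) : ℝ) ≠ 0 := by positivity
  have hflip (b : Bool) :
      |(if b then p 0 else 1 - p 0) - (if b then pt 0 else 1 - pt 0)| = δ := by
    rw [hp, hpt]
    cases b
    · simp only [Fin.val_zero, if_true, Bool.false_eq_true, if_false]
      rw [abs_of_nonpos] <;> linarith
    · simp only [Fin.val_zero, if_true]
      rw [abs_of_nonneg] <;> linarith
  have hdiff (x y) : |P x y - Pt x y| =
      δ / (m + 1 : ℕ) * (if ∀ j, j ≠ 0 → y j = x j then (1 : ℝ) else 0) := by
    have hsucc (i : Fin m) : p i.succ = pt i.succ := by simp [hp, hpt]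
    rw [hP, hPt, Fin.sum_univ_succ, Fin.sum_univ_succ]
    simp only [hsucc]
    rw [add_sub_add_right_eq_sub, ← sub_mul, ← mul_sub, abs_mul, abs_mul, hflip,
      abs_of_nonneg (by positivity : (0 : ℝ) ≤ 1 / (m + 1 : ℕ)),
      abs_of_nonneg (by split_ifs <;> norm_num)]
    ring
  have hdist (x) : |π x - πt x| = δ * (1 / 2) ^ m := by
    have hhalf (b : Bool) : (if b then (1 / 2 : ℝ) else 1 - 1 / 2) = 1 / 2 := by
      cases b <;> norm_num
    have hsucc (i : Fin m) : p i.succ = 1 / 2 ∧ pt i.succ = 1 / 2 := by simp [hp, hpt]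
    rw [hπ, hπt, Fin.prod_univ_succ, Fin.prod_univ_succ]
    simp only [hsucc, hhalf, prod_const, card_univ, Fintype.card_fin]
    rw [← sub_mul, abs_mul, hflip, abs_of_nonneg (by positivity)]
  constructor
  · simp_rw [hdiff, ← mul_sum, sum_agree_off_zero, ← sum_mul, hπ, sum_prod_bernoulli]
    ring
  · simp only [hdist, sum_const, card_univ, Fintype.card_fun, Fintype.card_bool,
      Fintype.card_fin, nsmul_eq_mul]
    push_cast
    rw [one_div_pow]
    field_simp
    ring
end
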